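/- arXiv:1909.09125 — 2 statements merged into one kernel-verified Lean document; each statement's English description precedes it below -/
import Mathlib

section
/- Let u : ℝ³ → ℝ³ be a divergence-free Schwartz vector field with vorticity ω = ∇×u and ω_h = (ω₁, ω₂, 0). Then for all −1 ≤ α ≤ 0 one has ‖∂₃u + ∇u₃‖²_{Ḣ^α} = ‖ω_h‖²_{Ḣ^α} = ‖∂₃u‖²_{Ḣ^α} + ‖∇u₃‖²_{Ḣ^α}, where ∂₃u is the vector (∂₃u₁, ∂₃u₂, ∂₃u₃) and ∇u₃ = (∂₁u₃, ∂₂u₃, ∂₃u₃). -/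
open MeasureTheory Real SchwartzMap
open scoped FourierTransform ENNReal

noncomputable section

/-- Euclidean three-space. -/
abbrev E3 : Type := EuclideanSpace ℝ (Fin 3)

/-- The `i`-th standard basis vector. -/
def ee (i : Fin 3) : E3 := EuclideanSpace.single i 1

/-- The partial derivative `∂ᵢ f`. -/
def pd (i : Fin 3) (f : E3 → ℝ) : E3 → ℝ := fun x => fderiv ℝ f x (ee i)

/-- The Fourier transform (kernel `e^{-2πi x·ξ}`) of a real-valued function. -/
def ft (f : E3 → ℝ) : E3 → ℂ := 𝓕 (fun x => (f x : ℂ))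

/-- The squared homogeneous Sobolev norm `‖v‖²_{Ḣ^s}` of a vector field,
computed componentwise. -/
def hsV (s : ℝ) (v : Fin 3 → E3 → ℝ) : ℝ :=
  ∫ ξ : E3, (2 * π * ‖ξ‖) ^ (2 * s) * ∑ i, ‖ft (v i) ξ‖ ^ 2

/-- The squared homogeneous Sobolev norm `‖A‖²_{Ḣ^s}` of a matrix field,
computed entrywise (Frobenius norm). -/
def hsM (s : ℝ) (A : Fin 3 → Fin 3 → E3 → ℝ) : ℝ :=
  ∫ ξ : E3, (2 * π * ‖ξ‖) ^ (2 * s) * ∑ i, ∑ j, ‖ft (A i j) ξ‖ ^ 2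

/-- The curl `ω = ∇ × u` of a vector field. -/
def curl (u : Fin 3 → E3 → ℝ) : Fin 3 → E3 → ℝ :=
  ![fun x => pd 1 (u 2) x - pd 2 (u 1) x,
    fun x => pd 2 (u 0) x - pd 0 (u 2) x,
    fun x => pd 0 (u 1) x - pd 1 (u 0) x]

/-- The strain tensor `S = (∇u + (∇u)ᵀ)/2`. -/
def strain (u : Fin 3 → E3 → ℝ) : Fin 3 → Fin 3 → E3 → ℝ :=
  fun i j x => (pd i (u j) x + pd j (u i) x) / 2

/-- Complexification of a real Schwartz function. -/
def cS (f : 𝓢(E3, ℝ)) : 𝓢(E3, ℂ) := SchwartzMap.postcompCLM Complex.ofRealCLM f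

lemma ft_coe (f : 𝓢(E3, ℝ)) (ξ : E3) : ft (⇑f) ξ = (𝓕 (cS f)) ξ := by
  rw [SchwartzMap.fourier_coe]; rfl

lemma cS_add (f g : 𝓢(E3, ℝ)) : cS (f + g) = cS f + cS g := map_add _ _ _

lemma ft_add (f g : 𝓢(E3, ℝ)) (ξ : E3) :
    ft (fun x => f x + g x) ξ = ft f ξ + ft g ξ := by
  have : (fun x => f x + g x) = ⇑(f + g) := rfl
  rw [this, ft_coe, ft_coe, ft_coe, cS_add, FourierTransform.fourier_add]; rfl

lemma ft_sub (f g : 𝓢(E3, ℝ)) (ξ : E3) :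
    ft (fun x => f x - g x) ξ = ft f ξ - ft g ξ := by
  have : (fun x => f x - g x) = ⇑(f - g) := rfl
  have h := ft_add (f - g) g ξ
  have e : (fun x => (f - g) x + g x) = ⇑f := by ext x; simp
  rw [e] at h
  rw [this, h]; ring

lemma ft_zero (ξ : E3) : ft (fun _ => 0) ξ = 0 := by
  have : (fun _ : E3 => (0:ℝ)) = ⇑(0 : 𝓢(E3, ℝ)) := rfl
  have h : cS 0 = 0 := map_zero _
  rw [this, ft_coe, h, FourierTransform.fourier_zero]; rfl

open LineDeriv in
lemma pd_coe (i : Fin 3) (f : 𝓢(E3, ℝ)) : pd i f = ⇑(∂_{ee i} f : 𝓢(E3, ℝ)) := by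
  ext x
  rw [SchwartzMap.lineDerivOp_apply_eq_fderiv]; rfl

open LineDeriv in
lemma cS_deriv (i : Fin 3) (f : 𝓢(E3, ℝ)) : cS (∂_{ee i} f) = ∂_{ee i} (cS f) := by
  ext x
  rw [SchwartzMap.lineDerivOp_apply_eq_fderiv]
  have h : HasFDerivAt (⇑(cS f)) (Complex.ofRealCLM.comp (fderiv ℝ f x)) x :=
    Complex.ofRealCLM.hasFDerivAt.comp x (f.differentiable x).hasFDerivAt
  rw [h.fderiv]
  change ((∂_{ee i} f x : ℝ) : ℂ) = _
  rw [SchwartzMap.lineDerivOp_apply_eq_fderiv]; rfl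

lemma ft_pd (i : Fin 3) (f : 𝓢(E3, ℝ)) (ξ : E3) :
    ft (pd i f) ξ = 2 * π * Complex.I * (ξ i : ℂ) * (𝓕 (cS f)) ξ := by
  have ht : (fun x : E3 => inner ℝ x (ee i)).HasTemperateGrowth :=
    ((innerSL ℝ).flip (ee i)).hasTemperateGrowth
  rw [pd_coe, ft_coe, cS_deriv, SchwartzMap.fourier_lineDerivOp_eq]
  rw [SchwartzMap.smul_apply, SchwartzMap.smulLeftCLM_apply_apply ht]
  simp [ee, EuclideanSpace.inner_single_right]
  ring

lemma rpow_bound {α : ℝ} (h1 : -1 ≤ α) (h2 : α ≤ 0) {r : ℝ} (hr : 0 ≤ r) :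
    r ^ (2 * α) * r ^ 2 ≤ 1 + r ^ 2 := by
  rcases hr.eq_or_lt with rfl | hr
  · simp
  rw [← Real.rpow_natCast r 2, ← Real.rpow_add hr]
  rcases le_total r 1 with h | h
  · have := Real.rpow_le_one hr.le h (show 0 ≤ 2 * α + (2:ℕ) by push_cast; linarith)
    have := Real.rpow_nonneg hr.le ((2:ℕ):ℝ)
    linarith
  · have := Real.rpow_le_rpow_of_exponent_le h
      (show 2 * α + (2:ℕ) ≤ (2:ℕ) by linarith)
    linarith

lemma integ_pow_sq (g : 𝓢(E3, ℂ)) (k : ℕ) :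
    Integrable (fun ξ : E3 => ‖ξ‖ ^ k * ‖g ξ‖ ^ 2) := by
  have h := (g.integrable_pow_mul volume k).mul_const (SchwartzMap.seminorm ℝ 0 0 g)
  refine h.mono' (by fun_prop) (Filter.Eventually.of_forall fun ξ => ?_)
  have := SchwartzMap.norm_le_seminorm ℝ g ξ
  rw [Real.norm_of_nonneg (by positivity), sq, ← mul_assoc]
  gcongr

lemma integ_term {α : ℝ} (h1 : -1 ≤ α) (h2 : α ≤ 0) (i : Fin 3) (f : 𝓢(E3, ℝ)) :
    Integrable (fun ξ : E3 => (2 * π * ‖ξ‖) ^ (2 * α) * ‖ft (pd i f) ξ‖ ^ 2) := by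
  set g := 𝓕 (cS f) with hg
  have hint : Integrable (fun ξ : E3 => ‖ξ‖ ^ 0 * ‖g ξ‖ ^ 2 +
      (2 * π) ^ 2 * (‖ξ‖ ^ 2 * ‖g ξ‖ ^ 2)) :=
    (integ_pow_sq g 0).add ((integ_pow_sq g 2).const_mul _)
  have e : (fun ξ => ft (pd i f) ξ) = fun ξ => 2 * π * Complex.I * (ξ i : ℂ) * g ξ := by
    ext ξ; exact ft_pd i f ξ
  have e' : ∀ ξ, ft (pd i f) ξ = 2 * π * Complex.I * (ξ i : ℂ) * g ξ := ft_pd i f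
  simp only [e']
  have hgc : Continuous (fun ξ => g ξ) := g.continuous
  refine hint.mono' ?_ (Filter.Eventually.of_forall fun ξ => ?_)
  · refine AEStronglyMeasurable.mul ?_ ?_
    · exact (Measurable.pow_const (by fun_prop) _).aestronglyMeasurable
    · exact Continuous.aestronglyMeasurable (by fun_prop)
  · have hb := rpow_bound h1 h2 (r := 2 * π * ‖ξ‖) (by positivity)
    rw [Real.norm_of_nonneg (by positivity)]
    have hx : ‖ξ i‖ ≤ ‖ξ‖ := PiLp.norm_apply_le ξ i
    have hn : ‖2 * π * Complex.I * (ξ i : ℂ) * g ξ‖ ≤ (2 * π * ‖ξ‖) * ‖g ξ‖ := by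
      simp only [norm_mul, Complex.norm_I, Complex.norm_real]
      rw [Real.norm_of_nonneg Real.pi_pos.le]
      simp only [Complex.norm_ofNat, mul_one]
      gcongr
    calc _ ≤ (2 * π * ‖ξ‖) ^ (2 * α) * ((2 * π * ‖ξ‖) * ‖g ξ‖) ^ 2 := by gcongr
      _ = ((2 * π * ‖ξ‖) ^ (2 * α) * (2 * π * ‖ξ‖) ^ 2) * ‖g ξ‖ ^ 2 := by ring
      _ ≤ (1 + (2 * π * ‖ξ‖) ^ 2) * ‖g ξ‖ ^ 2 := by gcongr
      _ = _ := by ring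

lemma integ_sum {α : ℝ} (h1 : -1 ≤ α) (h2 : α ≤ 0) (k : Fin 3 → Fin 3) (f : Fin 3 → 𝓢(E3, ℝ)) :
    Integrable (fun ξ : E3 => (2 * π * ‖ξ‖) ^ (2 * α) * ∑ i, ‖ft (pd (k i) (f i)) ξ‖ ^ 2) := by
  simp only [Finset.mul_sum]
  exact integrable_finsetSum _ fun i _ => integ_term h1 h2 (k i) (f i)

lemma norm_sq_c (z : ℂ) : ‖z‖ ^ 2 = z.re ^ 2 + z.im ^ 2 := by
  rw [Complex.sq_norm, Complex.normSq_apply]; ring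

/-- The pointwise algebraic identities. -/
lemma alg (x0 x1 x2 : ℝ) (a b c : ℂ) (h : (x0:ℂ) * a + x1 * b + x2 * c = 0) :
    ‖(x2:ℂ) * a + x0 * c‖ ^ 2 + ‖(x2:ℂ) * b + x1 * c‖ ^ 2 + ‖(x2:ℂ) * c + x2 * c‖ ^ 2 =
      ‖(x1:ℂ) * c - x2 * b‖ ^ 2 + ‖(x2:ℂ) * a - x0 * c‖ ^ 2 ∧
    ‖(x1:ℂ) * c - x2 * b‖ ^ 2 + ‖(x2:ℂ) * a - x0 * c‖ ^ 2 =
      (‖(x2:ℂ) * a‖ ^ 2 + ‖(x2:ℂ) * b‖ ^ 2 + ‖(x2:ℂ) * c‖ ^ 2) +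
      (‖(x0:ℂ) * c‖ ^ 2 + ‖(x1:ℂ) * c‖ ^ 2 + ‖(x2:ℂ) * c‖ ^ 2) := by
  have hr := congrArg Complex.re h
  have hi := congrArg Complex.im h
  simp at hr hi
  simp only [norm_sq_c]
  simp
  constructor
  · linear_combination 4 * x2 * c.re * hr + 4 * x2 * c.im * hi
  · linear_combination -2 * x2 * c.re * hr - 2 * x2 * c.im * hi

lemma div_ft (u : Fin 3 → 𝓢(E3, ℝ)) (hdiv : ∀ x : E3, ∑ i, pd i (⇑(u i)) x = 0) (ξ : E3) :
    ft (pd 0 (u 0)) ξ + ft (pd 1 (u 1)) ξ + ft (pd 2 (u 2)) ξ = 0 := by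
  have h : (fun _ : E3 => (0:ℝ)) = fun x => (pd 0 (u 0) x + pd 1 (u 1) x) + pd 2 (u 2) x := by
    ext x; rw [← hdiv x, Fin.sum_univ_three]
  have h0 := ft_zero ξ
  rw [h] at h0
  simp only [pd_coe] at h0 ⊢
  rw [← ft_add, ← h0]
  exact (ft_add (_ + _) _ ξ).symm

/-- For a divergence-free Schwartz vector field `u` with vorticity `ω` and
`ω_h = (ω₁, ω₂, 0)`: for all `−1 ≤ α ≤ 0`,
`‖∂₃u + ∇u₃‖²_{Ḣ^α} = ‖ω_h‖²_{Ḣ^α} = ‖∂₃u‖²_{Ḣ^α} + ‖∇u₃‖²_{Ḣ^α}`. -/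
theorem statement1 (u : Fin 3 → 𝓢(E3, ℝ))
    (hdiv : ∀ x : E3, ∑ i, pd i (⇑(u i)) x = 0)
    (α : ℝ) (hα₁ : -1 ≤ α) (hα₂ : α ≤ 0)
    (ω : Fin 3 → E3 → ℝ) (hω : ω = curl (fun i => ⇑(u i)))
    (ωh : Fin 3 → E3 → ℝ) (hωh : ωh = ![ω 0, ω 1, fun _ => 0])
    (v3 : Fin 3 → E3 → ℝ) (hv3 : v3 = fun j x => pd 2 (⇑(u j)) x + pd j (⇑(u 2)) x)
    (d3u : Fin 3 → E3 → ℝ) (hd3u : d3u = fun j => pd 2 (⇑(u j)))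
    (gu3 : Fin 3 → E3 → ℝ) (hgu3 : gu3 = fun j => pd j (⇑(u 2))) :
    hsV α v3 = hsV α ωh ∧ hsV α ωh = hsV α d3u + hsV α gu3 := by
  subst hω hωh hv3 hd3u hgu3
  have key : ∀ ξ : E3,
      (∑ j, ‖ft (fun x => pd 2 (⇑(u j)) x + pd j (⇑(u 2)) x) ξ‖ ^ 2 =
        ∑ j, ‖ft ((![curl (fun i => ⇑(u i)) 0, curl (fun i => ⇑(u i)) 1, fun _ => 0] :
          Fin 3 → E3 → ℝ) j) ξ‖ ^ 2) ∧
      (∑ j, ‖ft ((![curl (fun i => ⇑(u i)) 0, curl (fun i => ⇑(u i)) 1, fun _ => 0] :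
          Fin 3 → E3 → ℝ) j) ξ‖ ^ 2 =
        ∑ j, ‖ft (pd 2 (u j)) ξ‖ ^ 2 + ∑ j, ‖ft (pd j (u 2)) ξ‖ ^ 2) := by
    intro ξ
    have hd := div_ft u hdiv ξ
    have hA : ∀ i j k l, ft (fun x => pd i (⇑(u j)) x + pd k (⇑(u l)) x) ξ =
        ft (pd i (u j)) ξ + ft (pd k (u l)) ξ := by
      intro i j k l; simp only [pd_coe]; exact ft_add _ _ ξ
    have hS : ∀ i j k l, ft (fun x => pd i (⇑(u j)) x - pd k (⇑(u l)) x) ξ =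
        ft (pd i (u j)) ξ - ft (pd k (u l)) ξ := by
      intro i j k l; simp only [pd_coe]; exact ft_sub _ _ ξ
    simp only [Fin.sum_univ_three, curl, Matrix.cons_val_zero, Matrix.cons_val_one,
      Matrix.cons_val, hA, hS, ft_zero]
    simp only [ft_pd] at hd ⊢
    set c : ℂ := 2 * π * Complex.I
    have h' := alg (ξ 0) (ξ 1) (ξ 2) (c * (𝓕 (cS (u 0))) ξ) (c * (𝓕 (cS (u 1))) ξ)
      (c * (𝓕 (cS (u 2))) ξ) (by linear_combination hd)
    have hc : ∀ (x : ℝ) (z : ℂ), (x : ℂ) * (c * z) = c * x * z := by intros; ring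
    simp only [hc] at h'
    simpa using h'
  have i1 := integ_sum hα₁ hα₂ (fun _ => 2) u
  have i2 := integ_sum hα₁ hα₂ (fun j => j) (fun _ => u 2)
  constructor
  · unfold hsV
    exact integral_congr_ae (Filter.Eventually.of_forall fun ξ => by
      simp only [(key ξ).1])
  · unfold hsV
    rw [← integral_add i1 i2]
    exact integral_congr_ae (Filter.Eventually.of_forall fun ξ => by
      simp only [(key ξ).2, mul_add])
end
end

section
/- Fix 1 < q < ∞. There exists a constant C_q ≥ 1 depending only on q such that for every divergence-free Schwartz vector field u : ℝ³ → ℝ³, with ω = ∇×u and ω_h = (ω₁, ω₂, 0), one has (1/C_q)‖ω_h‖_{L^q(ℝ³)} ≤ ‖∂₃u + ∇u₃‖_{L^q(ℝ³)} ≤ C_q‖ω_h‖_{L^q(ℝ³)}, where ∂₃u + ∇u₃ is the vector field with components ∂₃u_j + ∂_j u₃, j = 1,2,3. -/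
open MeasureTheory Real SchwartzMap
open scoped FourierTransform ENNReal

noncomputable section

/-- The `L^q` norm of a vector field on `ℝ³` (pointwise Euclidean norm). -/
def lqV (q : ℝ) (v : Fin 3 → E3 → ℝ) : ℝ :=
  (eLpNorm (fun x => (EuclideanSpace.equiv (Fin 3) ℝ).symm (fun i => v i x))
    (ENNReal.ofReal q) volume).toReal

/-- A classical solution of the heat equation on `(0,∞) × ℝ³`, with its derivatives. -/
structure HeatSol (U : ℝ → E3 → ℝ) (U1 U2 : Fin 3 → ℝ → E3 → ℝ) : Prop where
  diff : ∀ t, 0 < t → Differentiable ℝ (U t)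
  pd1 : ∀ i t, 0 < t → pd i (U t) = U1 i t
  diff1 : ∀ i t, 0 < t → Differentiable ℝ (U1 i t)
  pd2 : ∀ i t, 0 < t → pd i (U1 i t) = U2 i t
  heat : ∀ t x, 0 < t → HasDerivAt (fun r => U r x) (∑ i, U2 i t x) t
  cont : ContinuousOn (fun z : ℝ × E3 => U z.1 z.2) (Set.Ioi 0 ×ˢ Set.univ)
  cont1 : ∀ i, ContinuousOn (fun z : ℝ × E3 => U1 i z.1 z.2) (Set.Ioi 0 ×ˢ Set.univ)
  cont2 : ∀ i, ContinuousOn (fun z : ℝ × E3 => U2 i z.1 z.2) (Set.Ioi 0 ×ˢ Set.univ)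

lemma hasDerivAt_line {f : E3 → ℝ} (hf : Differentiable ℝ f) (i : Fin 3) (x : E3) :
    HasDerivAt (fun r : ℝ => f (x + r • ee i)) (pd i f x) 0 :=
  ((hf x).hasFDerivAt.hasLineDerivAt (ee i))

lemma pd_eq_of_line {f : E3 → ℝ} (hf : Differentiable ℝ f) (i : Fin 3) (x : E3) {d : ℝ}
    (h : HasDerivAt (fun r : ℝ => f (x + r • ee i)) d 0) : pd i f x = d :=
  (hasDerivAt_line hf i x).unique h

def bel (s κ U w : ℝ) : ℝ := U ^ 2 * w ^ s + κ * w ^ (2 - s)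

def bel1 (s κ U w u' w' : ℝ) : ℝ :=
  2 * U * u' * w ^ s + s * U ^ 2 * w ^ (s - 1) * w' + κ * (2 - s) * w ^ (1 - s) * w'

def belQ (s κ U w u' w' : ℝ) : ℝ :=
  2 * w ^ s * u' ^ 2 + 4 * s * U * w ^ (s - 1) * u' * w'
    + (s * (s - 1) * U ^ 2 * w ^ (s - 2) + κ * (2 - s) * (1 - s) * w ^ (-s)) * w' ^ 2

lemma bel_deriv (s κ : ℝ) {U w : ℝ → ℝ} {u' w' t : ℝ} (hU : HasDerivAt U u' t)
    (hw : HasDerivAt w w' t) (hpos : 0 < w t) :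
    HasDerivAt (fun r => bel s κ (U r) (w r)) (bel1 s κ (U t) (w t) u' w') t := by
  have h1 := hw.rpow_const (p := s) (Or.inl hpos.ne')
  have h2 := hw.rpow_const (p := 2 - s) (Or.inl hpos.ne')
  have h := ((hU.pow 2).mul h1).add (h2.const_mul κ)
  refine h.congr_deriv ?_
  simp only [bel1]
  rw [show 2 - s - 1 = 1 - s by ring]
  simp only [Pi.pow_apply]
  norm_num
  ring

lemma bel1_deriv (s κ : ℝ) {U w U1 w1 : ℝ → ℝ} {u' w' u'' w'' t : ℝ} (hU : HasDerivAt U u' t)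
    (hw : HasDerivAt w w' t) (hU1 : HasDerivAt U1 u'' t)
    (hw1 : HasDerivAt w1 w'' t) (e1 : U1 t = u') (e2 : w1 t = w') (hpos : 0 < w t) :
    HasDerivAt (fun r => bel1 s κ (U r) (w r) (U1 r) (w1 r))
      (belQ s κ (U t) (w t) u' w' + bel1 s κ (U t) (w t) u'' w'') t := by
  have h1 := hw.rpow_const (p := s) (Or.inl hpos.ne')
  have h2 := hw.rpow_const (p := s - 1) (Or.inl hpos.ne')
  have h3 := hw.rpow_const (p := 1 - s) (Or.inl hpos.ne')
  have h := ((((hU.const_mul 2).mul hU1).mul h1).add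
    ((((hU.pow 2).const_mul s).mul h2).mul hw1)).add ((h3.const_mul (κ * (2 - s))).mul hw1)
  refine h.congr_deriv ?_
  simp only [bel1, belQ]
  rw [show s - 1 - 1 = s - 2 by ring, show 1 - s - 1 = -s by ring]
  simp only [Pi.pow_apply, Pi.mul_apply, e1, e2]
  norm_num
  ring

/-- The key pointwise convexity estimate. -/
lemma belQ_ge {s κ U w u' w' : ℝ} (hs0 : 0 ≤ s) (hs1 : s < 1) (hw : 0 < w)
    (hU : |U| ≤ w ^ (1 - s)) (hκ : 6 ≤ κ * (2 - s) * (1 - s)) :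
    w ^ s * u' ^ 2 + w ^ (-s) * w' ^ 2 ≤ belQ s κ U w u' w' := by
  set b : ℝ := w ^ (s / 2) with hb
  have hbpos : 0 < b := rpow_pos_of_pos hw _
  have hws : w ^ s = b ^ 2 := by
    rw [hb, ← rpow_natCast, ← rpow_mul hw.le]; congr 1; norm_num
  have hwm : w ^ (-s) = (b⁻¹) ^ 2 := by rw [rpow_neg hw.le, hws]; simp
  set V := U * w ^ (s - 1) with hV
  have hVle : |V| ≤ 1 := by
    rw [hV, abs_mul, abs_of_pos (rpow_pos_of_pos hw (s-1))]
    calc |U| * w ^ (s - 1) ≤ w ^ (1 - s) * w ^ (s - 1) := by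
          gcongr
      _ = 1 := by rw [← rpow_add hw]; simp
  have e1 : U ^ 2 * w ^ (s - 2) = V ^ 2 * (b⁻¹) ^ 2 := by
    rw [← hwm, hV, mul_pow, ← rpow_natCast (w ^ (s - 1)), ← rpow_mul hw.le, mul_assoc,
      ← rpow_add hw]
    congr 2; push_cast; ring
  have hQ : belQ s κ U w u' w' = 2 * (b * u') ^ 2 + 4 * s * V * (b * u') * (b⁻¹ * w')
      + (s * (s - 1) * V ^ 2 + κ * (2 - s) * (1 - s)) * (b⁻¹ * w') ^ 2 := by
    have : belQ s κ U w u' w' = 2 * w ^ s * u' ^ 2 + 4 * s * (U * w ^ (s - 1)) * u' * w'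
    + (s * (s - 1) * (U ^ 2 * w ^ (s - 2)) + κ * (2 - s) * (1 - s) * w ^ (-s)) * w' ^ 2 := by
      simp only [belQ]; ring
    rw [this, e1, hws, hwm, ← hV]
    field_simp
  have hL : w ^ s * u' ^ 2 + w ^ (-s) * w' ^ 2 = (b * u') ^ 2 + (b⁻¹ * w') ^ 2 := by
    rw [hws, hwm]; ring
  rw [hQ, hL]
  set a := b * u'
  set e := b⁻¹ * w'
  have hV2 : V ^ 2 ≤ 1 := by rw [← sq_abs]; nlinarith [abs_nonneg V]
  have h1 : (s * V) ^ 2 ≤ 1 := by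
    rw [mul_pow]; nlinarith [sq_nonneg V]
  have h2 : s * (1 - s) * V ^ 2 ≤ 1 := by
    have : 0 ≤ s * (1 - s) := by nlinarith
    nlinarith
  have h3 : 0 ≤ (5 - s * (1 - s) * V ^ 2 - 4 * (s * V) ^ 2) * e ^ 2 :=
    mul_nonneg (by linarith) (sq_nonneg _)
  have h4 : 0 ≤ (κ * (2 - s) * (1 - s) - 6) * e ^ 2 := mul_nonneg (by linarith) (sq_nonneg _)
  nlinarith [sq_nonneg (a + 2 * (s * V) * e)]

lemma belQ_ge_abs {s κ : ℝ} {U w : ℝ} {u' w' : Fin 3 → ℝ} (hs0 : 0 ≤ s) (hs1 : s < 1) (hw : 0 < w)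
    (hU : |U| ≤ w ^ (1 - s)) (hκ : 6 ≤ κ * (2 - s) * (1 - s)) (k j : Fin 3) :
    |u' k| * |w' j| ≤ ∑ i, belQ s κ U w (u' i) (w' i) := by
  have hpos : 0 < w ^ s := rpow_pos_of_pos hw _
  have h1 : ∑ i, (w ^ s * (u' i) ^ 2 + w ^ (-s) * (w' i) ^ 2) ≤
      ∑ i, belQ s κ U w (u' i) (w' i) :=
    Finset.sum_le_sum fun i _ => belQ_ge hs0 hs1 hw hU hκ
  have h2 : w ^ s * (u' k) ^ 2 ≤ ∑ i, w ^ s * (u' i) ^ 2 :=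
    Finset.single_le_sum (f := fun i => w ^ s * (u' i) ^ 2) (fun i _ => by positivity)
      (Finset.mem_univ k)
  have h3 : w ^ (-s) * (w' j) ^ 2 ≤ ∑ i, w ^ (-s) * (w' i) ^ 2 :=
    Finset.single_le_sum (f := fun i => w ^ (-s) * (w' i) ^ 2) (fun i _ => by positivity)
      (Finset.mem_univ j)
  rw [Finset.sum_add_distrib] at h1
  have h4 : 2 * (|u' k| * |w' j|) ≤ w ^ s * (u' k) ^ 2 + w ^ (-s) * (w' j) ^ 2 := by
    rw [rpow_neg hw.le, ← sq_abs (u' k), ← sq_abs (w' j)]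
    have h5 : 0 ≤ (w ^ s)⁻¹ * (w ^ s * |u' k| - |w' j|) ^ 2 := by positivity
    have h6 : (w ^ s)⁻¹ * (w ^ s * |u' k| - |w' j|) ^ 2 =
      w ^ s * |u' k| ^ 2 + (w ^ s)⁻¹ * |w' j| ^ 2 - 2 * (|u' k| * |w' j|) := by
      field_simp; ring
    linarith
  have h7 : 0 ≤ |u' k| * |w' j| := by positivity
  linarith

lemma contOn_slice {f : ℝ → E3 → ℝ}
    (hf : ContinuousOn (fun z : ℝ × E3 => f z.1 z.2) (Set.Ioi 0 ×ˢ Set.univ)) {t : ℝ} (ht : 0 < t) :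
    Continuous (f t) := by
  have : ContinuousOn (fun x : E3 => f t x) Set.univ :=
    hf.comp (f := fun x : E3 => (t, x)) (by fun_prop) (fun x _ => ⟨ht, trivial⟩)
  exact continuousOn_univ.1 this

lemma contOn_slice_t {f : ℝ → E3 → ℝ}
    (hf : ContinuousOn (fun z : ℝ × E3 => f z.1 z.2) (Set.Ioi 0 ×ˢ Set.univ)) (x : E3) :
    ContinuousOn (fun t => f t x) (Set.Ioi 0) :=
  hf.comp (f := fun t : ℝ => (t, x)) (by fun_prop) (fun t ht => ⟨ht, trivial⟩)

lemma contOn_integral_cpt {φ : E3 → ℝ} (hφ : Continuous φ) (hc : HasCompactSupport φ)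
    {f : ℝ → E3 → ℝ}
    (hf : ContinuousOn (fun z : ℝ × E3 => f z.1 z.2) (Set.Ioi 0 ×ˢ Set.univ)) :
    ContinuousOn (fun t => ∫ x, φ x * f t x) (Set.Ioi 0) := by
  refine continuousOn_integral_of_compact_support (k := tsupport φ) hc ?_ ?_
  · exact (hφ.comp continuous_snd).continuousOn.mul hf
  · intro t x _ hx
    simp [image_eq_zero_of_notMem_tsupport hx]

lemma integrable_cpt_mul {φ f : E3 → ℝ} (hφ : Continuous φ) (hc : HasCompactSupport φ)
    (hf : Continuous f) : Integrable (fun x => φ x * f x) :=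
  (hφ.mul hf).integrable_of_hasCompactSupport hc.mul_right

lemma hasDeriv_integral_cpt {φ : E3 → ℝ} (hφ : Continuous φ) (hc : HasCompactSupport φ)
    {f f' : ℝ → E3 → ℝ}
    (hf : ContinuousOn (fun z : ℝ × E3 => f z.1 z.2) (Set.Ioi 0 ×ˢ Set.univ))
    (hf' : ContinuousOn (fun z : ℝ × E3 => f' z.1 z.2) (Set.Ioi 0 ×ˢ Set.univ))
    (hd : ∀ t x, 0 < t → HasDerivAt (fun r => f r x) (f' t x) t) {t : ℝ} (ht : 0 < t) :
    HasDerivAt (fun r => ∫ x, φ x * f r x) (∫ x, φ x * f' t x) t := by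
  have hK : IsCompact (Set.Icc (t/2) (2*t) ×ˢ tsupport φ) := isCompact_Icc.prod hc
  have hsub : Set.Icc (t/2) (2*t) ×ˢ tsupport φ ⊆ Set.Ioi (0:ℝ) ×ˢ (Set.univ : Set E3) :=
    fun z hz => ⟨lt_of_lt_of_le (by positivity) hz.1.1, trivial⟩
  obtain ⟨C, hC⟩ := hK.exists_bound_of_continuousOn (hf'.mono hsub)
  have hs : Set.Icc (t/2) (2*t) ∈ nhds t := Icc_mem_nhds (by linarith) (by linarith)
  refine (hasDerivAt_integral_of_dominated_loc_of_deriv_le (𝕜 := ℝ) (E := ℝ)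
    (F := fun r x => φ x * f r x) (F' := fun r x => φ x * f' r x)
    (bound := fun x => |φ x| * C) hs
    ?_ ?_ ?_ ?_ ?_ ?_).2
  · filter_upwards [hs] with r hr
    exact (integrable_cpt_mul hφ hc
      (contOn_slice hf (lt_of_lt_of_le (by positivity) hr.1))).aestronglyMeasurable
  · exact integrable_cpt_mul hφ hc (contOn_slice hf ht)
  · exact (integrable_cpt_mul hφ hc (contOn_slice hf' ht)).aestronglyMeasurable
  · refine Filter.Eventually.of_forall fun x r hr => ?_
    by_cases hx : x ∈ tsupport φ
    · rw [norm_mul]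
      exact mul_le_mul_of_nonneg_left (hC (r, x) ⟨hr, hx⟩) (abs_nonneg _)
    · simp [image_eq_zero_of_notMem_tsupport hx]
  · exact (hφ.abs.integrable_of_hasCompactSupport hc.norm).mul_const C
  · refine Filter.Eventually.of_forall fun x r hr => ?_
    exact (hd r x (lt_of_lt_of_le (by positivity) hr.1)).const_mul _

lemma pd_contDiff {φ : E3 → ℝ} {n : ℕ} (hφ : ContDiff ℝ (n + 1) φ) (i : Fin 3) :
    ContDiff ℝ n (pd i φ) := by
  have := hφ.fderiv_right (m := n) le_rfl
  exact this.clm_apply contDiff_const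

lemma pd_cpt {φ : E3 → ℝ} (hc : HasCompactSupport φ) (i : Fin 3) :
    HasCompactSupport (pd i φ) := hc.fderiv_apply ℝ (ee i)

/-- Integration by parts twice against a test function. -/
lemma ibp_test {φ f f1 f2 : E3 → ℝ} (hφ : ContDiff ℝ 2 φ) (hc : HasCompactSupport φ) (i : Fin 3)
    (hf : Differentiable ℝ f) (e1 : pd i f = f1) (hf1 : Differentiable ℝ f1) (e2 : pd i f1 = f2)
    (hc2 : Continuous f2) : ∫ x, φ x * f2 x = ∫ x, pd i (pd i φ) x * f x := by
  have hφ1 : ContDiff ℝ 1 (pd i φ) := pd_contDiff (n := 1) (by exact_mod_cast hφ) i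
  have hφ2 : ContDiff ℝ 0 (pd i (pd i φ)) := pd_contDiff (n := 0) (by simpa using hφ1) i
  have hcφ1 := pd_cpt hc i
  have hcφ2 := pd_cpt hcφ1 i
  have a1 : ∫ x, φ x * f2 x = - ∫ x, pd i φ x * f1 x := by
    rw [← e2]
    refine integral_mul_fderiv_eq_neg_fderiv_mul_of_integrable ?_ ?_ ?_ ?_ ?_
    · exact integrable_cpt_mul hφ1.continuous hcφ1 hf1.continuous
    · exact integrable_cpt_mul hφ.continuous hc (f := pd i f1) (e2 ▸ hc2)
    · exact integrable_cpt_mul hφ.continuous hc hf1.continuous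
    · exact fun x _ => hφ.differentiable (by norm_num) x
    · exact fun x _ => hf1 x
  have a2 : ∫ x, pd i φ x * f1 x = - ∫ x, pd i (pd i φ) x * f x := by
    rw [← e1]
    refine integral_mul_fderiv_eq_neg_fderiv_mul_of_integrable ?_ ?_ ?_ ?_ ?_
    · exact integrable_cpt_mul hφ2.continuous hcφ2 hf.continuous
    · exact integrable_cpt_mul hφ1.continuous hcφ1 (f := pd i f) (e1 ▸ hf1.continuous)
    · exact integrable_cpt_mul hφ1.continuous hcφ1 hf.continuous
    · exact fun x _ => hφ1.differentiable (by norm_num) x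
    · exact fun x _ => hf x
  rw [a1, a2, neg_neg]

/-- `β` is a subsolution of the heat equation, with defect `Q ≥ 0`. -/
structure SubSol (β Q : ℝ → E3 → ℝ) (β1 β2 : Fin 3 → ℝ → E3 → ℝ) : Prop where
  diff : ∀ t, 0 < t → Differentiable ℝ (β t)
  pd1 : ∀ i t, 0 < t → pd i (β t) = β1 i t
  diff1 : ∀ i t, 0 < t → Differentiable ℝ (β1 i t)
  pd2 : ∀ i t, 0 < t → pd i (β1 i t) = β2 i t
  heat : ∀ t x, 0 < t → HasDerivAt (fun r => β r x) ((∑ i, β2 i t x) - Q t x) t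
  cont : ContinuousOn (fun z : ℝ × E3 => β z.1 z.2) (Set.Ioi 0 ×ˢ Set.univ)
  cont2 : ∀ i, ContinuousOn (fun z : ℝ × E3 => β2 i z.1 z.2) (Set.Ioi 0 ×ˢ Set.univ)
  contQ : ContinuousOn (fun z : ℝ × E3 => Q z.1 z.2) (Set.Ioi 0 ×ˢ Set.univ)

lemma flow_cut {β Q : ℝ → E3 → ℝ} {β1 β2 : Fin 3 → ℝ → E3 → ℝ} (h : SubSol β Q β1 β2)
    {φ : E3 → ℝ} (hφ : ContDiff ℝ 2 φ) (hc : HasCompactSupport φ) (h0 : ∀ x, 0 ≤ φ x)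
    (h1 : ∀ x, φ x ≤ 1) {A m : ℝ} (hA : ∀ x, ∑ i, |pd i (pd i φ) x| ≤ A)
    (hβ : ∀ t x, 0 < t → 0 ≤ β t x) (hInt0 : ∀ t, 0 < t → Integrable (β t))
    (hm : ∀ t, 0 < t → ∫ x, β t x ≤ m) {δ T : ℝ} (hδ : 0 < δ) (hT : δ ≤ T) :
    ∫ t in δ..T, ∫ x, φ x * Q t x ≤ m + A * m * (T - δ) := by
  have hA0 : 0 ≤ A := (Finset.sum_nonneg fun i _ => abs_nonneg _).trans (hA 0)
  set H : ℝ → ℝ := fun t => ∫ x, φ x * β t x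
  set D : ℝ → ℝ := fun t => ∫ x, φ x * ((∑ i, β2 i t x) - Q t x)
  have hcD : ContinuousOn (fun z : ℝ × E3 => (∑ i, β2 i z.1 z.2) - Q z.1 z.2)
      (Set.Ioi 0 ×ˢ Set.univ) :=
    (continuousOn_finsetSum _ fun i _ => h.cont2 i).sub h.contQ
  have hd : ∀ t, 0 < t → HasDerivAt H (D t) t := fun t ht =>
    hasDeriv_integral_cpt hφ.continuous hc h.cont
      (f' := fun t x => (∑ i, β2 i t x) - Q t x) hcD h.heat ht
  have hIcc : Set.uIcc δ T ⊆ Set.Ioi 0 := by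
    rw [Set.uIcc_of_le hT]; exact fun t ht => lt_of_lt_of_le hδ ht.1
  have hDc : ContinuousOn D (Set.Ioi 0) := contOn_integral_cpt hφ.continuous hc
    (f := fun t x => (∑ i, β2 i t x) - Q t x) hcD
  have hQc : ContinuousOn (fun t => ∫ x, φ x * Q t x) (Set.Ioi 0) :=
    contOn_integral_cpt hφ.continuous hc h.contQ
  have ftc : ∫ t in δ..T, D t = H T - H δ :=
    intervalIntegral.integral_eq_sub_of_hasDerivAt (fun t ht => hd t (hIcc ht))
      ((hDc.mono hIcc).intervalIntegrable)
  have hle : ∀ t ∈ Set.Icc δ T, ∫ x, φ x * Q t x ≤ A * m - D t := by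
    intro t ht
    have ht0 : 0 < t := lt_of_lt_of_le hδ ht.1
    have i2 : ∀ i, Integrable (fun x => φ x * β2 i t x) := fun i =>
      integrable_cpt_mul hφ.continuous hc (contOn_slice (h.cont2 i) ht0)
    have iQ : Integrable (fun x => φ x * Q t x) :=
      integrable_cpt_mul hφ.continuous hc (contOn_slice h.contQ ht0)
    have eD : D t = (∑ i, ∫ x, pd i (pd i φ) x * β t x) - ∫ x, φ x * Q t x := by
      have : D t = ∫ x, ((∑ i, φ x * β2 i t x) - φ x * Q t x) := by
        simp only [D, mul_sub, Finset.mul_sum]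
      rw [this, integral_sub (integrable_finsetSum _ fun i _ => i2 i) iQ,
        integral_finsetSum _ fun i _ => i2 i]
      congr 1
      refine Finset.sum_congr rfl fun i _ => ?_
      exact ibp_test hφ hc i (h.diff t ht0) (h.pd1 i t ht0) (h.diff1 i t ht0) (h.pd2 i t ht0)
        (contOn_slice (h.cont2 i) ht0)
    have ib : ∀ i, Integrable (fun x => pd i (pd i φ) x * β t x) := fun i => by
      have hφ1 : ContDiff ℝ 1 (pd i φ) := pd_contDiff (n := 1) (by exact_mod_cast hφ) i
      have hφ2 : ContDiff ℝ 0 (pd i (pd i φ)) := pd_contDiff (n := 0) (by simpa using hφ1) i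
      exact integrable_cpt_mul hφ2.continuous (pd_cpt (pd_cpt hc i) i) (h.diff t ht0).continuous
    have eB : (∑ i, ∫ x, pd i (pd i φ) x * β t x) ≤ A * m := by
      rw [← integral_finsetSum _ fun i _ => ib i]
      calc ∫ x, ∑ i, pd i (pd i φ) x * β t x ≤ ∫ x, A * β t x := by
            refine integral_mono (integrable_finsetSum _ fun i _ => ib i)
              ((hInt0 t ht0).const_mul A) fun x => ?_
            simp only
            rw [← Finset.sum_mul]
            refine mul_le_mul_of_nonneg_right ?_ (hβ t x ht0)
            exact (Finset.sum_le_sum fun i _ => le_abs_self _).trans (hA x)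
        _ = A * ∫ x, β t x := integral_const_mul _ _
        _ ≤ A * m := mul_le_mul_of_nonneg_left (hm t ht0) hA0
    linarith
  have hT0 : 0 < T := lt_of_lt_of_le hδ hT
  have key : ∫ t in δ..T, ∫ x, φ x * Q t x ≤ ∫ t in δ..T, (A * m - D t) :=
    intervalIntegral.integral_mono_on hT ((hQc.mono hIcc).intervalIntegrable)
      (((continuousOn_const.sub hDc).mono hIcc).intervalIntegrable) hle
  rw [intervalIntegral.integral_sub (by simp) ((hDc.mono hIcc).intervalIntegrable), ftc,
    intervalIntegral.integral_const] at key
  have hHT : 0 ≤ H T := integral_nonneg fun x => mul_nonneg (h0 x) (hβ T x hT0)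
  have hHδ : H δ ≤ m := by
    refine le_trans (integral_mono (integrable_cpt_mul hφ.continuous hc (contOn_slice h.cont hδ))
      (hInt0 δ hδ) fun x => ?_) (hm δ hδ)
    exact mul_le_of_le_one_left (hβ δ x hδ) (h1 x)
  simp only [smul_eq_mul] at key
  linarith

lemma bel_subsol {U w : ℝ → E3 → ℝ} {U1 U2 w1 w2 : Fin 3 → ℝ → E3 → ℝ}
    (hU : HeatSol U U1 U2) (hw : HeatSol w w1 w2) (hpos : ∀ t x, 0 < t → 0 < w t x) (s κ : ℝ) :
    SubSol (fun t x => bel s κ (U t x) (w t x))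
      (fun t x => ∑ i, belQ s κ (U t x) (w t x) (U1 i t x) (w1 i t x))
      (fun i t x => bel1 s κ (U t x) (w t x) (U1 i t x) (w1 i t x))
      (fun i t x => belQ s κ (U t x) (w t x) (U1 i t x) (w1 i t x)
        + bel1 s κ (U t x) (w t x) (U2 i t x) (w2 i t x)) := by
  have hd : ∀ t, 0 < t → Differentiable ℝ (fun x => bel s κ (U t x) (w t x)) := by
    intro t ht x
    have a := hU.diff t ht x
    have b := hw.diff t ht x
    have c := (hpos t x ht).ne'
    unfold bel
    exact (((a.pow 2).mul (b.rpow_const (Or.inl c))).add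
      ((b.rpow_const (Or.inl c)).const_mul κ))
  have hd1 : ∀ i t, 0 < t → Differentiable ℝ
      (fun x => bel1 s κ (U t x) (w t x) (U1 i t x) (w1 i t x)) := by
    intro i t ht x
    have a := hU.diff t ht x
    have b := hw.diff t ht x
    have a1 := hU.diff1 i t ht x
    have b1 := hw.diff1 i t ht x
    have c := (hpos t x ht).ne'
    unfold bel1
    exact ((((a.const_mul 2).mul a1).mul (b.rpow_const (Or.inl c))).add
      ((((a.pow 2).const_mul s).mul (b.rpow_const (Or.inl c))).mul b1)).add
      (((b.rpow_const (Or.inl c)).const_mul _).mul b1)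
  have hne : ∀ z ∈ (Set.Ioi (0:ℝ) ×ˢ (Set.univ : Set E3)), w z.1 z.2 ≠ 0 :=
    fun z hz => (hpos z.1 z.2 hz.1).ne'
  have hrp : ∀ p : ℝ, ContinuousOn (fun z : ℝ × E3 => (w z.1 z.2) ^ p)
      (Set.Ioi (0:ℝ) ×ˢ (Set.univ : Set E3)) := fun p =>
    hw.cont.rpow_const fun z hz => Or.inl (hne z hz)
  have hcU := hU.cont
  have hcU1 := hU.cont1
  have hcU2 := hU.cont2
  have hcw1 := hw.cont1
  have hcw2 := hw.cont2
  have cQ : ∀ i, ContinuousOn (fun z : ℝ × E3 => belQ s κ (U z.1 z.2) (w z.1 z.2) (U1 i z.1 z.2)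
      (w1 i z.1 z.2)) (Set.Ioi 0 ×ˢ Set.univ) := by
    intro i
    unfold belQ
    have a1 := hcU1 i
    have a2 := hcw1 i
    have b1 := hrp s
    have b2 := hrp (s-1)
    have b3 := hrp (s-2)
    have b4 := hrp (-s)
    fun_prop
  refine ⟨hd, ?_, hd1, ?_, ?_, ?_, ?_, ?_⟩
  · intro i t ht
    funext x
    refine pd_eq_of_line (hd t ht) i x ?_
    have a := hasDerivAt_line (hU.diff t ht) i x
    have b := hasDerivAt_line (hw.diff t ht) i x
    rw [hU.pd1 i t ht] at a
    rw [hw.pd1 i t ht] at b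
    have := bel_deriv s κ a b (by simpa using hpos t x ht)
    simpa using this
  · intro i t ht
    funext x
    refine pd_eq_of_line (hd1 i t ht) i x ?_
    have a := hasDerivAt_line (hU.diff t ht) i x
    have b := hasDerivAt_line (hw.diff t ht) i x
    have a1 := hasDerivAt_line (hU.diff1 i t ht) i x
    have b1 := hasDerivAt_line (hw.diff1 i t ht) i x
    rw [hU.pd1 i t ht] at a
    rw [hw.pd1 i t ht] at b
    rw [hU.pd2 i t ht] at a1
    rw [hw.pd2 i t ht] at b1
    have := bel1_deriv s κ a b a1 b1 (by simp) (by simp) (by simpa using hpos t x ht)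
    simpa using this
  · intro t x ht
    have := bel_deriv s κ (hU.heat t x ht) (hw.heat t x ht) (hpos t x ht)
    refine this.congr_deriv ?_
    rw [Finset.sum_add_distrib, add_sub_cancel_left]
    simp only [bel1, Finset.sum_add_distrib, Finset.mul_sum, Finset.sum_mul]
  · unfold bel
    have b1 := hrp s
    have b2 := hrp (2-s)
    fun_prop
  · intro i
    refine (cQ i).add ?_
    unfold bel1
    have a1 := hcU2 i
    have a2 := hcw2 i
    have b1 := hrp s
    have b2 := hrp (s-1)
    have b3 := hrp (1-s)
    fun_prop
  · exact continuousOn_finsetSum _ fun i _ => cQ i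

lemma pd_scale {φ : E3 → ℝ} (hφ : Differentiable ℝ φ) (c : ℝ) (i : Fin 3) :
    pd i (fun x => φ (c • x)) = fun x => c * pd i φ (c • x) := by
  funext x
  have h1 : HasFDerivAt (fun x : E3 => c • x) (c • ContinuousLinearMap.id ℝ E3) x :=
    (hasFDerivAt_id x).const_smul c
  have h2 := ((hφ (c • x)).hasFDerivAt.comp x h1).fderiv
  change fderiv ℝ (φ ∘ fun x => c • x) x (ee i) = _
  rw [h2]
  simp [pd]

lemma exists_cutoff : ∃ (φ : ℕ → E3 → ℝ) (A : ℕ → ℝ), (∀ n, ContDiff ℝ 2 (φ n)) ∧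
    (∀ n, HasCompactSupport (φ n)) ∧ (∀ n x, 0 ≤ φ n x) ∧ (∀ n x, φ n x ≤ 1) ∧
    (∀ n x, ∑ i, |pd i (pd i (φ n)) x| ≤ A n) ∧ Filter.Tendsto A Filter.atTop (nhds 0) ∧
    (∀ x, ∀ᶠ n in Filter.atTop, φ n x = 1) := by
  let b : ContDiffBump (0 : E3) := ⟨1, 2, by norm_num, by norm_num⟩
  have hb : ContDiff ℝ 2 (b : E3 → ℝ) := b.contDiff
  have hb1 : ∀ i, ContDiff ℝ 1 (pd i b) := fun i => pd_contDiff (n := 1) (by exact_mod_cast hb) i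
  have hb2 : ∀ i, ContDiff ℝ 0 (pd i (pd i b)) := fun i =>
    pd_contDiff (n := 0) (by simpa using hb1 i) i
  have hbd : ∀ i, ∃ C, ∀ x, ‖pd i (pd i b) x‖ ≤ C := fun i =>
    (hb2 i).continuous.bounded_above_of_compact_support (pd_cpt (pd_cpt b.hasCompactSupport i) i)
  choose C hC using hbd
  let c : ℕ → ℝ := fun n => 1 / ((n : ℝ) + 1)
  have hc : Filter.Tendsto c Filter.atTop (nhds 0) := tendsto_one_div_add_atTop_nhds_zero_nat
  have hc0 : ∀ n, 0 < c n := fun n => Nat.one_div_pos_of_nat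
  refine ⟨fun n x => b (c n • x), fun n => (c n)^2 * ∑ i, C i, ?_, ?_, ?_, ?_, ?_, ?_, ?_⟩
  · intro n
    exact hb.comp (contDiff_const_smul _)
  · intro n
    exact b.hasCompactSupport.comp_smul (hc0 n).ne'
  · intro n x; exact b.nonneg
  · intro n x; exact b.le_one
  · intro n x
    beta_reduce
    rw [Finset.mul_sum]
    refine Finset.sum_le_sum fun i _ => ?_
    have e1 : pd i (fun x => b (c n • x)) = fun x => c n * pd i b (c n • x) :=
      pd_scale (hb.differentiable (by norm_num)) _ i
    have e2 : pd i (fun x => c n * pd i b (c n • x)) x = c n * (c n * pd i (pd i b) (c n • x)) := by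
      have := pd_scale ((hb1 i).differentiable (by norm_num)) (c n) i
      rw [← congrFun this x]
      have hdd : DifferentiableAt ℝ (fun x => pd i b (c n • x)) x :=
        (((hb1 i).comp (contDiff_const_smul (c n))).differentiable (by norm_num)) x
      unfold pd at hdd ⊢
      rw [fderiv_const_mul hdd]
      rfl
    rw [e1, e2, ← mul_assoc, abs_mul, ← sq, abs_of_nonneg (sq_nonneg _)]
    exact mul_le_mul_of_nonneg_left (hC i _) (sq_nonneg _)
  · simpa using (hc.pow 2).mul_const (∑ i, C i)
  · intro x
    have : Filter.Tendsto (fun n => c n * ‖x‖) Filter.atTop (nhds 0) := by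
      simpa using hc.mul_const ‖x‖
    filter_upwards [this.eventually (gt_mem_nhds (zero_lt_one))] with n hn
    refine b.one_of_mem_closedBall ?_
    rw [mem_closedBall_zero_iff, norm_smul, Real.norm_of_nonneg (hc0 n).le]
    exact hn.le

lemma flow_full {β Q : ℝ → E3 → ℝ} {β1 β2 : Fin 3 → ℝ → E3 → ℝ} (h : SubSol β Q β1 β2)
    {m : ℝ} (hQ : ∀ t x, 0 < t → 0 ≤ Q t x)
    (hβ : ∀ t x, 0 < t → 0 ≤ β t x) (hInt0 : ∀ t, 0 < t → Integrable (β t))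
    (hm : ∀ t, 0 < t → ∫ x, β t x ≤ m) {δ T : ℝ} (hδ : 0 < δ) (hT : δ ≤ T) :
    ∫⁻ t in Set.Ioc δ T, ∫⁻ x, ENNReal.ofReal (Q t x) ≤ ENNReal.ofReal m := by
  obtain ⟨φ, A, hφ, hc, h0, h1, hA, hA0, hev⟩ := exists_cutoff
  have hin : ∀ n t, 0 < t → ∫⁻ x, ENNReal.ofReal (φ n x * Q t x)
      = ENNReal.ofReal (∫ x, φ n x * Q t x) := fun n t ht =>
    (ofReal_integral_eq_lintegral_ofReal
      (integrable_cpt_mul (hφ n).continuous (hc n) (contOn_slice h.contQ ht))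
      (Filter.Eventually.of_forall fun x => mul_nonneg (h0 n x) (hQ t x ht))).symm
  have hcont : ∀ n, ContinuousOn (fun t => ∫ x, φ n x * Q t x) (Set.Ioi 0) := fun n =>
    contOn_integral_cpt (hφ n).continuous (hc n) h.contQ
  have hIoc : Set.Ioc δ T ⊆ Set.Ioi 0 := fun t ht => lt_trans hδ ht.1
  have hIcc : Set.uIcc δ T ⊆ Set.Ioi 0 := by
    rw [Set.uIcc_of_le hT]; exact fun t ht => lt_of_lt_of_le hδ ht.1
  have hae : ∀ᵐ t ∂(volume.restrict (Set.Ioc δ T)), t ∈ Set.Ioc δ T :=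
    ae_restrict_mem measurableSet_Ioc
  have hn : ∀ n, ∫⁻ t in Set.Ioc δ T, ∫⁻ x, ENNReal.ofReal (φ n x * Q t x)
      ≤ ENNReal.ofReal (m + A n * m * (T - δ)) := by
    intro n
    have e : ∫⁻ t in Set.Ioc δ T, ∫⁻ x, ENNReal.ofReal (φ n x * Q t x) =
        ∫⁻ t in Set.Ioc δ T, ENNReal.ofReal (∫ x, φ n x * Q t x) := by
      refine lintegral_congr_ae ?_
      filter_upwards [hae] with t ht using hin n t (hIoc ht)
    rw [e, ← ofReal_integral_eq_lintegral_ofReal]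
    · refine ENNReal.ofReal_le_ofReal ?_
      rw [← intervalIntegral.integral_of_le hT]
      exact flow_cut h (hφ n) (hc n) (h0 n) (h1 n) (hA n) hβ hInt0 hm hδ hT
    · exact (((hcont n).mono hIcc).intervalIntegrable).1
    · filter_upwards [hae] with t ht
      exact integral_nonneg fun x => mul_nonneg (h0 n x) (hQ t x (hIoc ht))
  have hlim : Filter.Tendsto (fun n => ENNReal.ofReal (m + A n * m * (T - δ))) Filter.atTop
      (nhds (ENNReal.ofReal m)) := by
    refine ENNReal.tendsto_ofReal ?_
    simpa using ((hA0.mul_const m).mul_const (T - δ)).const_add m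
  have hmeas : ∀ n, AEMeasurable (fun t => ∫⁻ x, ENNReal.ofReal (φ n x * Q t x))
      (volume.restrict (Set.Ioc δ T)) := by
    intro n
    have : AEMeasurable (fun t => ENNReal.ofReal (∫ x, φ n x * Q t x))
        (volume.restrict (Set.Ioc δ T)) :=
      (((hcont n).mono hIoc).aemeasurable measurableSet_Ioc).ennreal_ofReal
    refine this.congr ?_
    filter_upwards [hae] with t ht using (hin n t (hIoc ht)).symm
  calc ∫⁻ t in Set.Ioc δ T, ∫⁻ x, ENNReal.ofReal (Q t x)
      ≤ ∫⁻ t in Set.Ioc δ T, Filter.liminf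
          (fun n => ∫⁻ x, ENNReal.ofReal (φ n x * Q t x)) Filter.atTop := by
        refine lintegral_mono_ae ?_
        filter_upwards [hae] with t ht
        have e : ∀ x, Filter.liminf (fun n => ENNReal.ofReal (φ n x * Q t x)) Filter.atTop
            = ENNReal.ofReal (Q t x) := by
          intro x
          refine Filter.Tendsto.liminf_eq ?_
          refine tendsto_const_nhds.congr' ?_
          filter_upwards [hev x] with n hn
          rw [hn, one_mul]
        simp_rw [← e]
        refine lintegral_liminf_le' fun n => ?_
        exact ((((hφ n).continuous).mul
          (contOn_slice h.contQ (hIoc ht))).measurable.ennreal_ofReal).aemeasurable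
    _ ≤ Filter.liminf (fun n => ∫⁻ t in Set.Ioc δ T, ∫⁻ x, ENNReal.ofReal (φ n x * Q t x))
          Filter.atTop := lintegral_liminf_le' hmeas
    _ ≤ Filter.liminf (fun n => ENNReal.ofReal (m + A n * m * (T - δ))) Filter.atTop :=
        Filter.liminf_le_liminf (Filter.Eventually.of_forall hn)
    _ = ENNReal.ofReal m := hlim.liminf_eq

/-- Bilinear embedding for abstract heat solutions. -/
lemma embed_abstract {U w : ℝ → E3 → ℝ} {U1 U2 w1 w2 : Fin 3 → ℝ → E3 → ℝ}
    (hU : HeatSol U U1 U2) (hw : HeatSol w w1 w2) (hpos : ∀ t x, 0 < t → 0 < w t x) {s κ m : ℝ}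
    (hs0 : 0 ≤ s) (hs1 : s < 1) (hκ : 6 ≤ κ * (2 - s) * (1 - s)) (hκ0 : 0 ≤ κ)
    (hUw : ∀ t x, 0 < t → |U t x| ≤ (w t x) ^ (1 - s))
    (hInt0 : ∀ t, 0 < t → Integrable (fun x => (w t x) ^ (2 - s)))
    (hm : ∀ t, 0 < t → ∫ x, (w t x) ^ (2 - s) ≤ m) (k j : Fin 3) {δ T : ℝ} (hδ : 0 < δ)
    (hT : δ ≤ T) :
    ∫⁻ t in Set.Ioc δ T, ∫⁻ x, ENNReal.ofReal (|U1 k t x| * |w1 j t x|)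
      ≤ ENNReal.ofReal ((1 + κ) * m) := by
  have hsub := bel_subsol hU hw hpos s κ
  have hb : ∀ t x, 0 < t → bel s κ (U t x) (w t x) ≤ (1 + κ) * (w t x) ^ (2 - s) := by
    intro t x ht
    have hp := hpos t x ht
    have : U t x ^ 2 ≤ (w t x ^ (1 - s)) ^ 2 := by
      rw [← sq_abs (U t x)]
      exact pow_le_pow_left₀ (abs_nonneg _) (hUw t x ht) 2
    have e : (w t x ^ (1 - s)) ^ 2 * w t x ^ s = w t x ^ (2 - s) := by
      rw [← rpow_natCast, ← rpow_mul hp.le, ← rpow_add hp]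
      congr 1; push_cast; ring
    have h2 := mul_le_mul_of_nonneg_right this (rpow_nonneg hp.le s)
    unfold bel
    linarith
  have hb0 : ∀ t x, 0 < t → 0 ≤ bel s κ (U t x) (w t x) := by
    intro t x ht
    have hp := hpos t x ht
    unfold bel; positivity
  have hQ : ∀ t x, 0 < t → |U1 k t x| * |w1 j t x| ≤
      ∑ i, belQ s κ (U t x) (w t x) (U1 i t x) (w1 i t x) := fun t x ht =>
    belQ_ge_abs (u' := fun i => U1 i t x) (w' := fun i => w1 i t x) hs0 hs1 (hpos t x ht)
      (hUw t x ht) hκ k j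
  have hbi : ∀ t, 0 < t → Integrable (fun x => bel s κ (U t x) (w t x)) := by
    intro t ht
    refine ((hInt0 t ht).const_mul (1 + κ)).mono' (hsub.diff t ht).continuous.aestronglyMeasurable
      (Filter.Eventually.of_forall fun x => ?_)
    rw [Real.norm_of_nonneg (hb0 t x ht)]
    exact hb t x ht
  refine le_trans ?_ (flow_full hsub (m := (1 + κ) * m) ?_ hb0 hbi ?_ hδ hT)
  · refine lintegral_mono_ae ?_
    filter_upwards [ae_restrict_mem measurableSet_Ioc] with t ht
    exact lintegral_mono fun x => ENNReal.ofReal_le_ofReal (hQ t x (lt_trans hδ ht.1))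
  · exact fun t x ht => le_trans (by positivity) (hQ t x ht)
  · intro t ht
    calc ∫ x, bel s κ (U t x) (w t x) ≤ ∫ x, (1 + κ) * (w t x) ^ (2 - s) :=
          integral_mono (hbi t ht) ((hInt0 t ht).const_mul _) fun x => hb t x ht
      _ = (1 + κ) * ∫ x, (w t x) ^ (2 - s) := integral_const_mul _ _
      _ ≤ (1 + κ) * m := mul_le_mul_of_nonneg_left (hm t ht) (by linarith)

/-- The heat kernel. -/
def hk (t : ℝ) (z : E3) : ℝ := (4 * π * t) ^ (-(3/2) : ℝ) * rexp (-(‖z‖ ^ 2 / (4 * t)))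
def hk1 (i : Fin 3) (t : ℝ) (z : E3) : ℝ := -(z i / (2 * t)) * hk t z
def hk2 (i j : Fin 3) (t : ℝ) (z : E3) : ℝ :=
  (z i * z j / (4 * t ^ 2) - (if i = j then 1 / (2 * t) else 0)) * hk t z

def cv (k f : E3 → ℝ) (x : E3) : ℝ := ∫ y, k (x - y) * f y

lemma hk_pos {t : ℝ} (ht : 0 < t) (z : E3) : 0 < hk t z := by
  unfold hk; positivity

lemma abs_coord_le (z : E3) (i : Fin 3) : |z i| ≤ ‖z‖ := PiLp.norm_apply_le z i

def hbd (δ : ℝ) : ℝ := (1 + 1 / δ) * (4 * π * δ) ^ (-(3/2) : ℝ)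

lemma poly_bound {δ t : ℝ} (hδ : 0 < δ) (ht : δ ≤ t) (z : E3) {p : ℝ}
    (hp : |p| ≤ (1 + 1 / δ) * (1 + ‖z‖ ^ 2 / (4 * t))) : |p * hk t z| ≤ hbd δ := by
  have ht0 : 0 < t := lt_of_lt_of_le hδ ht
  set a := ‖z‖ ^ 2 / (4 * t) with ha
  have ha0 : 0 ≤ a := by positivity
  have e1 : (1 + a) * rexp (-a) ≤ 1 := by
    rw [exp_neg]
    have := add_one_le_exp a
    rw [← div_eq_mul_inv, div_le_one (exp_pos a)]; linarith
  have e2 : (4 * π * t) ^ (-(3/2) : ℝ) ≤ (4 * π * δ) ^ (-(3/2) : ℝ) :=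
    rpow_le_rpow_of_nonpos (by positivity) (by gcongr) (by norm_num)
  rw [abs_mul, abs_of_pos (hk_pos ht0 z)]
  unfold hk hbd
  rw [← ha]
  calc |p| * ((4 * π * t) ^ (-(3/2) : ℝ) * rexp (-a))
      ≤ ((1 + 1 / δ) * (1 + a)) * ((4 * π * δ) ^ (-(3/2) : ℝ) * rexp (-a)) := by gcongr
    _ = (1 + 1 / δ) * (4 * π * δ) ^ (-(3/2) : ℝ) * ((1 + a) * rexp (-a)) := by ring
    _ ≤ (1 + 1 / δ) * (4 * π * δ) ^ (-(3/2) : ℝ) * 1 := by gcongr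
    _ = _ := by ring

lemma hk_le {δ t : ℝ} (hδ : 0 < δ) (ht : δ ≤ t) (z : E3) : |hk t z| ≤ hbd δ := by
  have ht0 : 0 < t := lt_of_lt_of_le hδ ht
  have := poly_bound hδ ht z (p := 1) (by
    have h1 : 0 ≤ 1 / δ := by positivity
    have h2 : 0 ≤ ‖z‖ ^ 2 / (4 * t) := by positivity
    rw [abs_one]; nlinarith [mul_nonneg h1 h2])
  simpa using this

lemma hk1_le {δ t : ℝ} (hδ : 0 < δ) (ht : δ ≤ t) (i : Fin 3) (z : E3) : |hk1 i t z| ≤ hbd δ := by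
  have ht0 : 0 < t := lt_of_lt_of_le hδ ht
  refine poly_bound hδ ht z ?_
  set a := ‖z‖ ^ 2 / (4 * t) with ha
  have ha0 : 0 ≤ a := by positivity
  have h1 : 1 / t ≤ 1 / δ := one_div_le_one_div_of_le hδ ht
  have h2 : (‖z‖ / (2 * t)) ^ 2 = a * (1 / t) := by rw [ha]; field_simp; norm_num
  have h3 : |-(z i / (2 * t))| ≤ ‖z‖ / (2 * t) := by
    rw [abs_neg, abs_div, abs_of_pos (show 0 < 2 * t by positivity)]
    gcongr; exact abs_coord_le z i
  have h4 : ‖z‖ / (2 * t) ≤ 1 + (‖z‖ / (2 * t)) ^ 2 := by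
    nlinarith [sq_nonneg (‖z‖ / (2 * t) - 1)]
  have h5 : a * (1 / t) ≤ a * (1 / δ) := by gcongr
  have h6 : 0 ≤ 1 / δ := by positivity
  nlinarith

lemma hk2_le {δ t : ℝ} (hδ : 0 < δ) (ht : δ ≤ t) (i j : Fin 3) (z : E3) :
    |hk2 i j t z| ≤ hbd δ := by
  have ht0 : 0 < t := lt_of_lt_of_le hδ ht
  refine poly_bound hδ ht z ?_
  set a := ‖z‖ ^ 2 / (4 * t) with ha
  have ha0 : 0 ≤ a := by positivity
  have h1 : 1 / t ≤ 1 / δ := one_div_le_one_div_of_le hδ ht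
  have h3 : |z i * z j / (4 * t ^ 2)| ≤ a * (1 / t) := by
    rw [abs_div, abs_of_pos (show 0 < 4 * t ^ 2 by positivity), abs_mul, ha]
    have : a * (1 / t) = ‖z‖ * ‖z‖ / (4 * t ^ 2) := by rw [ha]; field_simp
    rw [← ha, this]
    gcongr <;> exact abs_coord_le z _
  have h4 : |(if i = j then 1 / (2 * t) else 0)| ≤ 1 / δ := by
    split_ifs
    · rw [abs_of_pos (by positivity)]
      exact one_div_le_one_div_of_le hδ (by linarith)
    · simp; positivity
  have h5 : a * (1 / t) ≤ a * (1 / δ) := by gcongr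
  have h6 := abs_sub (z i * z j / (4 * t ^ 2)) (if i = j then 1 / (2 * t) else 0)
  nlinarith

lemma hk_contDiff (t : ℝ) : ContDiff ℝ 2 (hk t) := by
  unfold hk
  exact contDiff_const.mul (((contDiff_norm_sq ℝ).div_const _).neg.exp)

lemma hk1_contDiff (i : Fin 3) (t : ℝ) : ContDiff ℝ 2 (hk1 i t) := by
  unfold hk1
  have : ContDiff ℝ 2 (fun z : E3 => z i) := by fun_prop
  exact (this.div_const _).neg.mul (hk_contDiff t)

lemma inner_ee (x : E3) (i : Fin 3) : inner ℝ x (ee i) = x i := by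
  rw [ee, EuclideanSpace.inner_single_right]; simp

lemma hk_pd (i : Fin 3) {t : ℝ} (ht : 0 < t) : pd i (hk t) = hk1 i t := by
  funext x
  refine pd_eq_of_line ((hk_contDiff t).differentiable (by norm_num)) i x ?_
  have e : ∀ r : ℝ, ‖x + r • ee i‖ ^ 2 = ‖x‖ ^ 2 + 2 * (r * x i) + r ^ 2 := by
    intro r
    rw [norm_add_sq_real, real_inner_smul_right, inner_ee, norm_smul]
    simp [ee]
  have h : HasDerivAt (fun r : ℝ => ‖x + r • ee i‖ ^ 2) (2 * x i) 0 := by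
    simp_rw [e]
    have := (((hasDerivAt_id (0:ℝ)).mul_const (x i)).const_mul 2).const_add (‖x‖ ^ 2)
    have := this.add ((hasDerivAt_id (0:ℝ)).pow 2)
    exact this.congr_deriv (by simp)
  have := ((h.div_const (4 * t)).neg.exp).const_mul ((4 * π * t) ^ (-(3/2) : ℝ))
  unfold hk1 hk
  refine this.congr_deriv ?_
  simp only [zero_smul, add_zero, Pi.neg_apply]
  field_simp
  norm_num

lemma hk1_pd (i j : Fin 3) {t : ℝ} (ht : 0 < t) : pd j (hk1 i t) = hk2 i j t := by
  funext x
  refine pd_eq_of_line ((hk1_contDiff i t).differentiable (by norm_num)) j x ?_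
  have h1 := hasDerivAt_line ((hk_contDiff t).differentiable (by norm_num)) j x
  rw [hk_pd j ht] at h1
  have h2 : HasDerivAt (fun r : ℝ => (x + r • ee j) i) (if i = j then 1 else 0) 0 := by
    have : ∀ r : ℝ, (x + r • ee j) i = x i + r * (if i = j then 1 else 0) := by
      intro r
      simp [ee]
    simp_rw [this]
    simpa using ((hasDerivAt_id (0:ℝ)).mul_const (if i = j then (1:ℝ) else 0)).const_add (x i)
  have := (h2.div_const (2 * t)).neg.mul h1
  unfold hk1 hk2 at *
  refine this.congr_deriv ?_
  simp only [zero_smul, add_zero, Pi.neg_apply]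
  split_ifs <;> field_simp <;> ring

lemma hk_heat {t : ℝ} (ht : 0 < t) (z : E3) :
    HasDerivAt (fun r => hk r z) (∑ i, hk2 i i t z) t := by
  have h1 : HasDerivAt (fun r : ℝ => (4 * π * r) ^ (-(3/2) : ℝ))
      (-(3 / (2 * t)) * (4 * π * t) ^ (-(3/2) : ℝ)) t := by
    have := ((hasDerivAt_id t).const_mul (4 * π)).rpow_const (p := (-(3/2) : ℝ))
      (Or.inl (by simp; positivity))
    refine this.congr_deriv ?_
    simp only [id]
    rw [rpow_sub_one (by positivity)]
    field_simp
  have h2 : HasDerivAt (fun r : ℝ => -(‖z‖ ^ 2 / (4 * r))) (‖z‖ ^ 2 / (4 * t ^ 2)) t := by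
    have := ((hasDerivAt_const t (‖z‖ ^ 2)).div ((hasDerivAt_id t).const_mul 4)
      (by simp; positivity)).neg
    refine this.congr_deriv ?_
    simp only [id]
    field_simp
    norm_num
  have := h1.mul h2.exp
  unfold hk2
  rw [← Finset.sum_mul]
  unfold hk
  refine this.congr_deriv ?_
  have : ‖z‖ ^ 2 = z 0 ^ 2 + z 1 ^ 2 + z 2 ^ 2 := by
    rw [EuclideanSpace.real_norm_sq_eq, Fin.sum_univ_three]
  simp only [Fin.sum_univ_three, if_true]
  rw [show z 0 * z 0 / (4 * t ^ 2) - 1 / (2 * t) + (z 1 * z 1 / (4 * t ^ 2) - 1 / (2 * t)) +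
    (z 2 * z 2 / (4 * t ^ 2) - 1 / (2 * t)) = ‖z‖ ^ 2 / (4 * t ^ 2) - 3 / (2 * t) by rw [this]; ring]
  ring

lemma hk_cont : ContinuousOn (fun z : ℝ × E3 => hk z.1 z.2) (Set.Ioi 0 ×ˢ Set.univ) := by
  unfold hk
  have h : ∀ z ∈ (Set.Ioi (0:ℝ) ×ˢ (Set.univ : Set E3)), z.1 ≠ 0 := fun z hz => ne_of_gt hz.1
  refine ContinuousOn.mul ?_ ?_
  · exact ContinuousOn.rpow_const (by fun_prop) fun z hz => Or.inl (by
      have := h z hz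
      have := pi_pos.ne'
      positivity)
  · refine ContinuousOn.rexp (ContinuousOn.neg (ContinuousOn.div (by fun_prop) (by fun_prop) ?_))
    intro z hz; have := h z hz; positivity

lemma hk1_cont (i : Fin 3) :
    ContinuousOn (fun z : ℝ × E3 => hk1 i z.1 z.2) (Set.Ioi 0 ×ˢ Set.univ) := by
  unfold hk1
  refine ContinuousOn.mul (ContinuousOn.neg (ContinuousOn.div (by fun_prop) (by fun_prop) ?_))
    hk_cont
  intro z hz; have : z.1 ≠ 0 := ne_of_gt hz.1
  positivity

lemma hk2_cont (i j : Fin 3) :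
    ContinuousOn (fun z : ℝ × E3 => hk2 i j z.1 z.2) (Set.Ioi 0 ×ˢ Set.univ) := by
  unfold hk2
  have h : ∀ z ∈ (Set.Ioi (0:ℝ) ×ˢ (Set.univ : Set E3)), z.1 ≠ 0 := fun z hz => ne_of_gt hz.1
  refine ContinuousOn.mul (ContinuousOn.sub (ContinuousOn.div (by fun_prop) (by fun_prop) ?_) ?_)
    hk_cont
  · intro z hz; have := h z hz; positivity
  · split_ifs
    · refine ContinuousOn.div (by fun_prop) (by fun_prop) ?_
      intro z hz; have := h z hz; positivity
    · fun_prop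

lemma ee_expand (v : E3) : v = ∑ i, v i • ee i := by
  ext j
  fin_cases j <;> simp [ee, Fin.sum_univ_three]

lemma clm_norm_le (L : E3 →L[ℝ] ℝ) {C : ℝ} (hC : ∀ i, |L (ee i)| ≤ C) : ‖L‖ ≤ 3 * C := by
  have hC0 : 0 ≤ C := (abs_nonneg _).trans (hC 0)
  refine L.opNorm_le_bound (by positivity) fun v => ?_
  conv_lhs => rw [ee_expand v]
  rw [map_sum]
  refine (norm_sum_le _ _).trans ?_
  have : ∀ i : Fin 3, ‖L (v i • ee i)‖ ≤ ‖v‖ * C := by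
    intro i
    rw [map_smul, norm_smul]
    exact mul_le_mul (abs_coord_le v i) (hC i) (norm_nonneg _) (norm_nonneg _)
  refine (Finset.sum_le_sum fun i _ => this i).trans ?_
  simp; linarith

lemma cv_integrable {k f : E3 → ℝ} (hk : Continuous k) {C : ℝ} (hC : ∀ z, |k z| ≤ C)
    (hf : Integrable f) (x : E3) : Integrable (fun y => k (x - y) * f y) :=
  hf.bdd_mul (c := C) (by fun_prop : Continuous fun y => k (x - y)).aestronglyMeasurable
    (Filter.Eventually.of_forall fun y => hC _)

lemma cv_bound {k f : E3 → ℝ} {C : ℝ} (hC : ∀ z, |k z| ≤ C)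
    (hf : Integrable f) (x : E3) : |cv k f x| ≤ C * ∫ y, |f y| := by
  unfold cv
  rw [← integral_const_mul, ← Real.norm_eq_abs]
  refine norm_integral_le_of_norm_le (hf.norm.const_mul C)
    (Filter.Eventually.of_forall fun y => ?_)
  rw [norm_mul]
  exact mul_le_mul_of_nonneg_right (hC _) (norm_nonneg _)

lemma cv_hasFDerivAt {k f : E3 → ℝ} (hk : ContDiff ℝ 1 k) {C : ℝ} (hC : ∀ z, |k z| ≤ C)
    {C' : ℝ} (hC' : ∀ i z, |pd i k z| ≤ C') (hf : Integrable f) (x : E3) :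
    HasFDerivAt (cv k f) (∫ y, f y • fderiv ℝ k (x - y)) x := by
  have hfd : Continuous (fderiv ℝ k) := hk.continuous_fderiv (by norm_num)
  refine hasFDerivAt_integral_of_dominated_of_fderiv_le (𝕜 := ℝ)
    (F := fun x y => k (x - y) * f y) (F' := fun x y => f y • fderiv ℝ k (x - y))
    (bound := fun y => |f y| * (3 * C')) Filter.univ_mem ?_ ?_ ?_ ?_ ?_ ?_
  · exact Filter.Eventually.of_forall fun x =>
      (cv_integrable hk.continuous hC hf x).aestronglyMeasurable
  · exact cv_integrable hk.continuous hC hf x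
  · exact hf.aestronglyMeasurable.smul
      (by fun_prop : Continuous fun y => fderiv ℝ k (x - y)).aestronglyMeasurable
  · refine Filter.Eventually.of_forall fun y x _ => ?_
    rw [norm_smul]
    exact mul_le_mul_of_nonneg_left (clm_norm_le _ fun i => hC' i _) (abs_nonneg _)
  · exact hf.norm.mul_const _
  · refine Filter.Eventually.of_forall fun y x _ => ?_
    have h1 := (hk.differentiable (by norm_num) (x - y)).hasFDerivAt
    have h2 : HasFDerivAt (fun x : E3 => x - y) (ContinuousLinearMap.id ℝ E3) x :=
      (hasFDerivAt_id x).sub_const y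
    exact (h1.comp x h2).mul_const (f y)

lemma cv_pd {k f : E3 → ℝ} (hk : ContDiff ℝ 1 k) {C : ℝ} (hC : ∀ z, |k z| ≤ C)
    {C' : ℝ} (hC' : ∀ i z, |pd i k z| ≤ C') (hf : Integrable f) (i : Fin 3) :
    pd i (cv k f) = cv (pd i k) f := by
  funext x
  have hfd : Continuous (fderiv ℝ k) := hk.continuous_fderiv (by norm_num)
  unfold pd
  rw [(cv_hasFDerivAt hk hC hC' hf x).fderiv]
  have hInt0 : Integrable (fun y => f y • fderiv ℝ k (x - y)) := by
    refine (hf.norm.mul_const (3 * C')).mono' (hf.aestronglyMeasurable.smul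
      (by fun_prop : Continuous fun y => fderiv ℝ k (x - y)).aestronglyMeasurable)
      (Filter.Eventually.of_forall fun y => ?_)
    rw [norm_smul]
    exact mul_le_mul_of_nonneg_left (clm_norm_le _ fun i => hC' i _) (norm_nonneg _)
  rw [ContinuousLinearMap.integral_apply hInt0]
  simp [cv, mul_comm]

lemma cv_cont {k : ℝ → E3 → ℝ}
    (hk : ContinuousOn (fun z : ℝ × E3 => k z.1 z.2) (Set.Ioi 0 ×ˢ Set.univ))
    {C : ℝ → ℝ} (hC : ∀ δ t z, 0 < δ → δ ≤ t → |k t z| ≤ C δ) {f : E3 → ℝ} (hf : Integrable f) :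
    ContinuousOn (fun z : ℝ × E3 => cv (k z.1) f z.2) (Set.Ioi 0 ×ˢ Set.univ) := by
  intro z hz
  refine ContinuousAt.continuousWithinAt ?_
  have hz0 : 0 < z.1 := hz.1
  have hev : ∀ᶠ p : ℝ × E3 in nhds z, z.1 / 2 ≤ p.1 :=
    continuous_fst.continuousAt.eventually (Ici_mem_nhds (by linarith))
  refine continuousAt_of_dominated (F := fun (p : ℝ × E3) y => k p.1 (p.2 - y) * f y)
    (bound := fun y => C (z.1/2) * |f y|) ?_ ?_ ?_ ?_
  · filter_upwards [hev] with p hp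
    exact (cv_integrable (contOn_slice hk (by linarith)) (fun w => hC _ _ w (half_pos hz0) hp)
      hf _).aestronglyMeasurable
  · filter_upwards [hev] with p hp
    refine Filter.Eventually.of_forall fun y => ?_
    rw [norm_mul]
    exact mul_le_mul_of_nonneg_right (hC _ _ _ (half_pos hz0) hp) (norm_nonneg _)
  · exact hf.norm.const_mul _
  · refine Filter.Eventually.of_forall fun y => ?_
    refine ContinuousAt.mul ?_ continuousAt_const
    have h1 : ContinuousAt (fun z : ℝ × E3 => k z.1 z.2) (z.1, z.2 - y) :=
      hk.continuousAt ((isOpen_Ioi.prod isOpen_univ).mem_nhds ⟨hz0, trivial⟩)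
    exact h1.comp (f := fun p : ℝ × E3 => (p.1, p.2 - y)) (by fun_prop)

/-- The heat extension of an integrable function is a heat solution. -/
lemma heatSol {f : E3 → ℝ} (hf : Integrable f) :
    HeatSol (fun t => cv (hk t) f) (fun i t => cv (hk1 i t) f) (fun i t => cv (hk2 i i t) f) := by
  have hp1 : ∀ i t, 0 < t → pd i (cv (hk t) f) = cv (hk1 i t) f := by
    intro i t ht
    rw [cv_pd ((hk_contDiff t).of_le (by norm_num)) (hk_le ht le_rfl)
      (fun i z => by rw [hk_pd i ht]; exact hk1_le ht le_rfl i z) hf, hk_pd i ht]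
  have hp2 : ∀ i j t, 0 < t → pd j (cv (hk1 i t) f) = cv (hk2 i j t) f := by
    intro i j t ht
    rw [cv_pd ((hk1_contDiff i t).of_le (by norm_num)) (hk1_le ht le_rfl i)
      (fun j z => by rw [hk1_pd i j ht]; exact hk2_le ht le_rfl i j z) hf, hk1_pd i j ht]
  refine ⟨?_, hp1, ?_, fun i t ht => hp2 i i t ht, ?_, ?_, ?_, ?_⟩
  · intro t ht x
    exact (cv_hasFDerivAt ((hk_contDiff t).of_le (by norm_num)) (hk_le ht le_rfl)
      (fun i z => by rw [hk_pd i ht]; exact hk1_le ht le_rfl i z) hf x).differentiableAt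
  · intro i t ht x
    exact (cv_hasFDerivAt ((hk1_contDiff i t).of_le (by norm_num)) (hk1_le ht le_rfl i)
      (fun j z => by rw [hk1_pd i j ht]; exact hk2_le ht le_rfl i j z) hf x).differentiableAt
  · intro t x ht
    have hs : Set.Ici (t/2) ∈ nhds t := Ici_mem_nhds (by linarith)
    have h2 : ∀ i, Integrable (fun y => hk2 i i t (x - y) * f y) := fun i =>
      cv_integrable (contOn_slice (hk2_cont i i) ht) (hk2_le ht le_rfl i i) hf x
    have e : ∑ i, cv (hk2 i i t) f x = ∫ y, (∑ i, hk2 i i t (x - y)) * f y := by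
      unfold cv
      rw [← integral_finsetSum _ fun i _ => h2 i]
      simp_rw [Finset.sum_mul]
    rw [e]
    refine (hasDerivAt_integral_of_dominated_loc_of_deriv_le (𝕜 := ℝ) (E := ℝ)
      (F := fun r y => hk r (x - y) * f y) (F' := fun r y => (∑ i, hk2 i i r (x - y)) * f y)
      (bound := fun y => (3 * hbd (t/2)) * |f y|) hs ?_ ?_ ?_ ?_ ?_ ?_).2
    · filter_upwards [hs] with r hr
      exact (cv_integrable (hk_contDiff r).continuous (hk_le (half_pos ht) hr)
        hf x).aestronglyMeasurable
    · exact cv_integrable (hk_contDiff t).continuous (hk_le ht le_rfl) hf x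
    · have : Integrable (fun y => ∑ i, hk2 i i t (x - y) * f y) :=
        integrable_finsetSum _ fun i _ => h2 i
      simp_rw [← Finset.sum_mul] at this
      exact this.aestronglyMeasurable
    · refine Filter.Eventually.of_forall fun y r hr => ?_
      rw [norm_mul]
      refine mul_le_mul_of_nonneg_right ?_ (norm_nonneg _)
      refine (norm_sum_le _ _).trans
        ((Finset.sum_le_sum fun i _ => hk2_le (half_pos ht) hr i i _).trans ?_)
      simp
    · exact hf.norm.const_mul _
    · refine Filter.Eventually.of_forall fun y r hr => ?_
      exact (hk_heat (lt_of_lt_of_le (half_pos ht) hr) _).mul_const _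
  · exact cv_cont hk_cont (fun δ t z hδ ht => hk_le hδ ht z) hf
  · exact fun i => cv_cont (hk1_cont i) (fun δ t z hδ ht => hk1_le hδ ht i z) hf
  · exact fun i => cv_cont (hk2_cont i i) (fun δ t z hδ ht => hk2_le hδ ht i i z) hf

lemma gauss_integral {b : ℝ} (hb : 0 < b) :
    ∫ v : E3, rexp (-b * ‖v‖ ^ 2) = (π / b) ^ (3 / 2 : ℝ) := by
  have := GaussianFourier.integral_rexp_neg_mul_sq_norm (V := E3) hb
  simpa using this

lemma gauss_integrable {b : ℝ} (hb : 0 < b) :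
    Integrable (fun v : E3 => rexp (-b * ‖v‖ ^ 2)) := by
  by_contra h
  have h1 := integral_undef h
  rw [gauss_integral hb] at h1
  have : 0 < (π / b) ^ (3 / 2 : ℝ) := by positivity
  linarith

lemma hk_eq (t : ℝ) : hk t = fun z => (4 * π * t) ^ (-(3/2) : ℝ) * rexp (-(1/(4*t)) * ‖z‖ ^ 2) := by
  funext z; unfold hk; congr 2; ring

lemma hk_integrable {t : ℝ} (ht : 0 < t) : Integrable (hk t) := by
  rw [hk_eq]; exact (gauss_integrable (by positivity)).const_mul _

lemma hk_integral {t : ℝ} (ht : 0 < t) : ∫ z, hk t z = 1 := by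
  rw [hk_eq, integral_const_mul, gauss_integral (by positivity),
    show π / (1 / (4 * t)) = 4 * π * t by field_simp, ← rpow_add (by positivity)]
  norm_num

lemma hk_integral_shift {t : ℝ} (ht : 0 < t) (x : E3) : ∫ y, hk t (x - y) = 1 := by
  rw [integral_sub_left_eq_self (hk t) volume x, hk_integral ht]

lemma hk_integrable_shift {t : ℝ} (ht : 0 < t) (x : E3) : Integrable (fun y => hk t (x - y)) :=
  (hk_integrable ht).comp_sub_left x

lemma cv_eq_convolution (k f : E3 → ℝ) :
    cv k f = MeasureTheory.convolution f k (ContinuousLinearMap.mul ℝ ℝ) volume := by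
  funext x; simp [cv, MeasureTheory.convolution, mul_comm]

lemma cv_integrable_all {k f : E3 → ℝ} (hk : Integrable k) (hf : Integrable f) :
    Integrable (cv k f) := by
  rw [cv_eq_convolution]; exact hf.integrable_convolution _ hk

lemma cv_integral {k f : E3 → ℝ} (hk : Integrable k) (hf : Integrable f) :
    ∫ x, cv k f x = (∫ z, k z) * ∫ y, f y := by
  rw [cv_eq_convolution, integral_convolution _ hf hk]; simp [mul_comm]

lemma hk_cv_integrable {t : ℝ} (ht : 0 < t) {f : E3 → ℝ} (hf : Integrable f) (x : E3) :
    Integrable (fun y => hk t (x - y) * f y) :=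
  cv_integrable (hk_contDiff t).continuous (hk_le ht le_rfl) hf x

lemma tangent {p a y : ℝ} (hp : 1 ≤ p) (ha : 0 < a) (hy : 0 ≤ y) :
    a ^ p + p * a ^ (p - 1) * (y - a) ≤ y ^ p := by
  have h := one_add_mul_self_le_rpow_one_add (s := y / a - 1) (by
    have : 0 ≤ y / a := by positivity
    linarith) hp
  rw [show 1 + (y / a - 1) = y / a by ring, div_rpow hy ha.le,
    le_div_iff₀ (rpow_pos_of_pos ha p)] at h
  refine le_trans (le_of_eq ?_) h
  rw [rpow_sub_one ha.ne']
  field_simp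

lemma jensen {t p : ℝ} (ht : 0 < t) (hp : 1 ≤ p) {f : E3 → ℝ} (hf : Integrable f)
    (h0 : ∀ x, 0 ≤ f x) (hfp : Integrable (fun x => f x ^ p)) (x : E3) :
    (cv (hk t) f x) ^ p ≤ cv (hk t) (fun y => f y ^ p) x := by
  have hnn : ∀ g : E3 → ℝ, (∀ y, 0 ≤ g y) → 0 ≤ cv (hk t) g x := fun g hg =>
    integral_nonneg fun y => mul_nonneg (hk_pos ht _).le (hg y)
  rcases (hnn f h0).eq_or_lt with h | h
  · rw [← h, zero_rpow (by linarith)]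
    exact hnn _ fun y => rpow_nonneg (h0 y) p
  · set a := cv (hk t) f x with ha
    have i1 := hk_cv_integrable ht hf x
    have i2 := hk_integrable_shift ht x
    have i3 : Integrable (fun y => hk t (x - y) * f y - a * hk t (x - y)) :=
      i1.sub (i2.const_mul a)
    have e : ∫ y, (a ^ p * hk t (x - y) + (p * a ^ (p - 1)) * (hk t (x - y) * f y - a * hk t (x - y)))
        = a ^ p := by
      rw [integral_add (i2.const_mul _) (i3.const_mul _), integral_const_mul,
        integral_const_mul, integral_sub i1 (i2.const_mul a), integral_const_mul,
        hk_integral_shift ht]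
      change _ + _ * (a - _) = _
      ring
    rw [← e]
    unfold cv
    refine integral_mono ((i2.const_mul _).add (i3.const_mul _))
      (hk_cv_integrable ht hfp x) fun y => ?_
    have := mul_le_mul_of_nonneg_left (tangent hp h (h0 y)) (hk_pos ht (x - y)).le
    simp only at this ⊢
    linarith

lemma cv_pos {t : ℝ} (ht : 0 < t) {M : E3 → ℝ} (hM : Integrable M) (h0 : ∀ x, 0 < M x) (x : E3) :
    0 < cv (hk t) M x := by
  unfold cv
  rw [integral_pos_iff_support_of_nonneg
    (fun y => (mul_pos (hk_pos ht _) (h0 y)).le) (hk_cv_integrable ht hM x)]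
  have : Function.support (fun y => hk t (x - y) * M y) = Set.univ := by
    ext y; simp [(hk_pos ht (x - y)).ne', (h0 y).ne']
  rw [this]; simp

lemma cv_mono {t : ℝ} (ht : 0 < t) {f g : E3 → ℝ} (hf : Integrable f) (hg : Integrable g)
    (h : ∀ x, f x ≤ g x) (x : E3) : cv (hk t) f x ≤ cv (hk t) g x :=
  integral_mono (hk_cv_integrable ht hf x) (hk_cv_integrable ht hg x) fun y =>
    mul_le_mul_of_nonneg_left (h y) (hk_pos ht _).le

lemma abs_cv_le {t : ℝ} (ht : 0 < t) {f : E3 → ℝ} (x : E3) :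
    |cv (hk t) f x| ≤ cv (hk t) (fun y => |f y|) x := by
  unfold cv
  rw [← Real.norm_eq_abs]
  refine (norm_integral_le_integral_norm _).trans (le_of_eq ?_)
  congr 1; funext y
  rw [norm_mul, Real.norm_of_nonneg (hk_pos ht _).le, Real.norm_eq_abs]

lemma embed1 {s κ : ℝ} (hs0 : 0 ≤ s) (hs1 : s < 1) (hκ : 6 ≤ κ * (2 - s) * (1 - s)) (hκ0 : 0 ≤ κ)
    {f M : E3 → ℝ} (hf : Integrable f) (hM : Integrable M) (h0 : ∀ x, 0 < M x)
    (hfM : ∀ x, |f x| ^ (1 / (1 - s)) ≤ M x) (hMq : Integrable (fun x => M x ^ (2 - s)))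
    (k j : Fin 3) {δ T : ℝ} (hδ : 0 < δ) (hT : δ ≤ T) :
    ∫⁻ t in Set.Ioc δ T, ∫⁻ x, ENNReal.ofReal (|cv (hk1 k t) f x| * |cv (hk1 j t) M x|)
      ≤ ENNReal.ofReal ((1 + κ) * ∫ x, M x ^ (2 - s)) := by
  have hs : 0 < 1 - s := by linarith
  have hp1 : 1 ≤ 1 / (1 - s) := by rw [le_div_iff₀ hs]; linarith
  have hfp : Integrable (fun x => |f x| ^ (1 / (1 - s))) := by
    refine hM.mono' ?_ (Filter.Eventually.of_forall fun x => ?_)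
    · exact (hf.aestronglyMeasurable.aemeasurable.norm.pow_const _).aestronglyMeasurable
    · rw [Real.norm_of_nonneg (by positivity)]; exact hfM x
  have hw : ∀ t, 0 < t → ∀ x, (cv (hk t) M x) ^ (2 - s) ≤ cv (hk t) (fun y => M y ^ (2 - s)) x :=
    fun t ht x => jensen ht (by linarith) hM (fun y => (h0 y).le) hMq x
  have hcv : ∀ t, 0 < t → Integrable (cv (hk t) (fun y => M y ^ (2 - s))) := fun t ht =>
    cv_integrable_all (hk_integrable ht) hMq
  have hInt0 : ∀ t, 0 < t → Integrable (fun x => (cv (hk t) M x) ^ (2 - s)) := by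
    intro t ht
    refine (hcv t ht).mono' ?_ (Filter.Eventually.of_forall fun x => ?_)
    · exact (((heatSol hM).diff t ht).continuous.rpow_const
        fun x => Or.inl (cv_pos ht hM h0 x).ne').aestronglyMeasurable
    · rw [Real.norm_of_nonneg (rpow_nonneg (cv_pos ht hM h0 x).le _)]
      exact hw t ht x
  refine embed_abstract (heatSol hf) (heatSol hM) (fun t x ht => cv_pos ht hM h0 x) hs0 hs1 hκ hκ0
    ?_ hInt0 ?_ k j hδ hT
  · intro t x ht
    have h1 : (cv (hk t) (fun y => |f y|) x) ^ (1 / (1 - s)) ≤ cv (hk t) M x :=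
      (jensen ht hp1 hf.norm (fun y => abs_nonneg _) hfp x).trans (cv_mono ht hfp hM hfM x)
    have h2 : 0 ≤ cv (hk t) (fun y => |f y|) x := (abs_nonneg _).trans (abs_cv_le ht x)
    refine (abs_cv_le ht x).trans ?_
    have h3 := rpow_le_rpow (rpow_nonneg h2 _) h1 hs.le
    rwa [← rpow_mul h2, one_div_mul_cancel hs.ne', rpow_one] at h3
  · intro t ht
    refine (integral_mono (hInt0 t ht) (hcv t ht) (hw t ht)).trans (le_of_eq ?_)
    rw [cv_integral (hk_integrable ht) hMq, hk_integral ht, one_mul]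

lemma three_rpow {a b c q : ℝ} (ha : 0 ≤ a) (hb : 0 ≤ b) (hc : 0 ≤ c) (hq : 0 ≤ q) :
    (a + b + c) ^ q ≤ 3 ^ q * (a ^ q + b ^ q + c ^ q) := by
  have key : ∀ m, 0 ≤ m → a ≤ m → b ≤ m → c ≤ m → (a + b + c) ^ q ≤ 3 ^ q * m ^ q := by
    intro m hm h1 h2 h3
    rw [← mul_rpow (by norm_num) hm]
    exact rpow_le_rpow (by positivity) (by linarith) hq
  have ea := rpow_nonneg ha q
  have eb := rpow_nonneg hb q
  have ec := rpow_nonneg hc q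
  have h3 : (0:ℝ) ≤ 3 ^ q := by positivity
  rcases le_total a b with h | h <;> rcases le_total b c with h' | h' <;>
    rcases le_total a c with h'' | h''
  all_goals
    first
    | exact (key a ha (by linarith) (by linarith) (by linarith)).trans
        (mul_le_mul_of_nonneg_left (by linarith) h3)
    | exact (key b hb (by linarith) (by linarith) (by linarith)).trans
        (mul_le_mul_of_nonneg_left (by linarith) h3)
    | exact (key c hc (by linarith) (by linarith) (by linarith)).trans
        (mul_le_mul_of_nonneg_left (by linarith) h3)

lemma cv_add {k f g : E3 → ℝ} (hk : Continuous k) {C : ℝ} (hC : ∀ z, |k z| ≤ C)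
    (hf : Integrable f) (hg : Integrable g) (x : E3) :
    cv k (fun y => f y + g y) x = cv k f x + cv k g x := by
  unfold cv
  rw [← integral_add (cv_integrable hk hC hf x) (cv_integrable hk hC hg x)]
  congr 1; funext y; ring

lemma aemeas_slab {F : ℝ → E3 → ℝ}
    (hF : ContinuousOn (fun z : ℝ × E3 => F z.1 z.2) (Set.Ioi 0 ×ˢ Set.univ)) {δ T : ℝ}
    (hδ : 0 < δ) : AEMeasurable (fun t => ∫⁻ x, ENNReal.ofReal (F t x))
      (volume.restrict (Set.Ioc δ T)) := by
  have h1 : AEMeasurable (fun z : ℝ × E3 => ENNReal.ofReal (F z.1 z.2))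
      ((volume.restrict (Set.Ioc δ T)).prod (volume : Measure E3)) := by
    have : (volume.restrict (Set.Ioc δ T)).prod (volume : Measure E3) =
        (volume.prod volume).restrict (Set.Ioc δ T ×ˢ (Set.univ : Set E3)) := by
      rw [← Measure.prod_restrict, Measure.restrict_univ]
    rw [this]
    refine (ContinuousOn.aemeasurable ?_ (measurableSet_Ioc.prod MeasurableSet.univ)).ennreal_ofReal
    exact hF.mono fun z hz => ⟨lt_trans hδ hz.1.1, trivial⟩
  exact h1.lintegral_prod_right'

/-- Bilinear embedding theorem (`p = (2-s)/(1-s) ≥ 2`, `q = 2 - s ≤ 2`). -/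
lemma embed2 {s : ℝ} (hs0 : 0 ≤ s) (hs1 : s < 1) : ∃ C : ℝ, 0 ≤ C ∧ ∀ f g : E3 → ℝ,
    Integrable f → Integrable g → Integrable (fun x => |f x| ^ (1 / (1 - s))) →
    Integrable (fun x => |f x| ^ ((2 - s) / (1 - s))) → Integrable (fun x => |g x| ^ (2 - s)) →
    ∫ x, |f x| ^ ((2 - s) / (1 - s)) ≤ 1 → ∫ x, |g x| ^ (2 - s) ≤ 1 →
    ∀ (k j : Fin 3) (δ T : ℝ), 0 < δ → δ ≤ T →
    ∫⁻ t in Set.Ioc δ T, ∫⁻ x, ENNReal.ofReal (|cv (hk1 k t) f x| * |cv (hk1 j t) g x|)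
      ≤ ENNReal.ofReal C := by
  have hs : 0 < 1 - s := by linarith
  set κ : ℝ := 6 / ((2 - s) * (1 - s)) with hκd
  have hd : 0 < (2 - s) * (1 - s) := by nlinarith
  have hκ0 : 0 ≤ κ := by positivity
  have hκ : 6 ≤ κ * (2 - s) * (1 - s) := by
    rw [mul_assoc, hκd, div_mul_cancel₀ _ hd.ne']
  set G : E3 → ℝ := fun x => rexp (-1 * ‖x‖ ^ 2) with hG
  have hGi : Integrable G := gauss_integrable one_pos
  have hGq : ∀ x, G x ^ (2 - s) = rexp (-(2 - s) * ‖x‖ ^ 2) := by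
    intro x; rw [hG]; simp only; rw [← exp_mul]; congr 1; ring
  have hGqi : Integrable (fun x => G x ^ (2 - s)) := by
    simp_rw [hGq]; exact gauss_integrable (by linarith)
  set c0 := ∫ x, G x ^ (2 - s) with hc0
  have hc00 : 0 ≤ c0 := integral_nonneg fun x => rpow_nonneg (exp_pos _).le _
  set m : ℝ := 2 ^ (2 - s) * (3 ^ (2 - s) * (1 + 1 + c0)) with hm
  have hm0 : 0 ≤ m := by positivity
  refine ⟨(1 + κ) * m + (1 + κ) * m, by positivity, ?_⟩
  intro f g hf hg hf1 hfp hgq hfle hgle k j δ T hδ hT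
  set M : E3 → ℝ := fun x => |g x| + |f x| ^ (1 / (1 - s)) + G x with hM
  have hMi : Integrable M := (hg.norm.add hf1).add hGi
  have hfnn : ∀ x, 0 ≤ |f x| ^ (1 / (1 - s)) := fun x => by positivity
  have hGp : ∀ x, 0 < G x := fun x => exp_pos _
  have hMp : ∀ x, 0 < M x := fun x => by
    have := hGp x; have := hfnn x; have := abs_nonneg (g x); simp only [hM]; linarith
  have hMgp : ∀ x, 0 < M x + g x := fun x => by
    have := hGp x; have := hfnn x; have := neg_abs_le (g x); simp only [hM]; linarith
  have hfM : ∀ x, |f x| ^ (1 / (1 - s)) ≤ M x := fun x => by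
    have := hGp x; have := abs_nonneg (g x); simp only [hM]; linarith
  have hfMg : ∀ x, |f x| ^ (1 / (1 - s)) ≤ M x + g x := fun x => by
    have := hGp x; have := neg_abs_le (g x); simp only [hM]; linarith
  have hfe : ∀ x, (|f x| ^ (1 / (1 - s))) ^ (2 - s) = |f x| ^ ((2 - s) / (1 - s)) := fun x => by
    rw [← rpow_mul (abs_nonneg _)]; congr 1; ring
  have hS : Integrable (fun x => 2 ^ (2 - s) * (3 ^ (2 - s) *
      (|g x| ^ (2 - s) + |f x| ^ ((2 - s) / (1 - s)) + G x ^ (2 - s)))) :=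
    (((hgq.add hfp).add hGqi).const_mul _).const_mul _
  have hSle : ∫ x, 2 ^ (2 - s) * (3 ^ (2 - s) *
      (|g x| ^ (2 - s) + |f x| ^ ((2 - s) / (1 - s)) + G x ^ (2 - s))) ≤ m := by
    have hgf : Integrable (fun x => |g x| ^ (2 - s) + |f x| ^ ((2 - s) / (1 - s))) := hgq.add hfp
    rw [integral_const_mul, integral_const_mul, integral_add hgf hGqi,
      integral_add hgq hfp, hm]
    gcongr
  have hb : ∀ N : E3 → ℝ, (∀ x, 0 < N x) → (∀ x, N x ≤ 2 * M x) → ∀ x, N x ^ (2 - s) ≤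
      2 ^ (2 - s) * (3 ^ (2 - s) *
      (|g x| ^ (2 - s) + |f x| ^ ((2 - s) / (1 - s)) + G x ^ (2 - s))) := by
    intro N hN0 hN x
    refine (rpow_le_rpow (hN0 x).le (hN x) (by linarith)).trans ?_
    rw [mul_rpow (by norm_num) (hMp x).le]
    refine mul_le_mul_of_nonneg_left ?_ (by positivity)
    refine (three_rpow (abs_nonneg _) (hfnn x) (hGp x).le (by linarith)).trans (le_of_eq ?_)
    rw [hfe]
  have gen : ∀ N : E3 → ℝ, Integrable N → (∀ x, 0 < N x) → (∀ x, N x ≤ 2 * M x) →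
      (∀ x, |f x| ^ (1 / (1 - s)) ≤ N x) →
      ∫⁻ t in Set.Ioc δ T, ∫⁻ x, ENNReal.ofReal (|cv (hk1 k t) f x| * |cv (hk1 j t) N x|)
        ≤ ENNReal.ofReal ((1 + κ) * m) := by
    intro N hNi hN0 hN hfN
    have hNq : Integrable (fun x => N x ^ (2 - s)) := by
      refine hS.mono' ?_ (Filter.Eventually.of_forall fun x => ?_)
      · exact (hNi.aestronglyMeasurable.aemeasurable.pow_const _).aestronglyMeasurable
      · rw [Real.norm_of_nonneg (rpow_nonneg (hN0 x).le _)]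
        exact hb N hN0 hN x
    refine (embed1 hs0 hs1 hκ hκ0 hf hNi hN0 hfN hNq k j hδ hT).trans
      (ENNReal.ofReal_le_ofReal (mul_le_mul_of_nonneg_left ?_ (by linarith)))
    exact (integral_mono hNq hS (hb N hN0 hN)).trans hSle
  have g1 := gen M hMi hMp (fun x => by linarith [hMp x]) hfM
  have g2 := gen (fun x => M x + g x) (hMi.add hg) hMgp (fun x => by
    have := le_abs_self (g x); have := hfnn x; have := hGp x
    have : g x ≤ M x := by simp only [hM]; linarith
    linarith) hfMg
  rw [ENNReal.ofReal_add (by positivity) (by positivity)]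
  refine le_trans ?_ (add_le_add g2 g1)
  have hcF : ∀ N : E3 → ℝ, Integrable N → ContinuousOn (fun z : ℝ × E3 =>
      |cv (hk1 k z.1) f z.2| * |cv (hk1 j z.1) N z.2|) (Set.Ioi 0 ×ˢ Set.univ) := fun N hN =>
    ((heatSol hf).cont1 k).abs.mul ((heatSol hN).cont1 j).abs
  rw [← lintegral_add_right' _
    (aemeas_slab (F := fun t x => |cv (hk1 k t) f x| * |cv (hk1 j t) M x|) (hcF M hMi) hδ)]
  refine lintegral_mono_ae ?_
  filter_upwards [ae_restrict_mem measurableSet_Ioc] with t ht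
  have ht0 : 0 < t := lt_trans hδ ht.1
  rw [← lintegral_add_right _ (contOn_slice
    (f := fun t x => |cv (hk1 k t) f x| * |cv (hk1 j t) M x|) (hcF M hMi)
      ht0).measurable.ennreal_ofReal]
  refine lintegral_mono fun x => ?_
  rw [← ENNReal.ofReal_add (by positivity) (by positivity)]
  refine ENNReal.ofReal_le_ofReal ?_
  rw [← mul_add]
  refine mul_le_mul_of_nonneg_left ?_ (abs_nonneg _)
  rw [cv_add (hk1_contDiff j t).continuous (hk1_le ht0 le_rfl j) hMi hg]
  have := abs_sub (cv (hk1 j t) M x + cv (hk1 j t) g x) (cv (hk1 j t) M x)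
  rwa [add_sub_cancel_left] at this

/-- The partial derivative of a Schwartz function, as a Schwartz function. -/
def spd (i : Fin 3) (f : 𝓢(E3, ℝ)) : 𝓢(E3, ℝ) :=
  SchwartzMap.evalCLM ℝ E3 ℝ (ee i) (SchwartzMap.fderivCLM ℝ E3 ℝ f)

lemma spd_coe (i : Fin 3) (f : 𝓢(E3, ℝ)) : ⇑(spd i f) = pd i f := by
  funext x; simp [spd, pd]

lemma pd_comm (i j : Fin 3) (f : 𝓢(E3, ℝ)) (x : E3) : pd i (pd j f) x = pd j (pd i f) x := by
  have hs : ContDiff ℝ 2 f := f.smooth 2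
  have h1 : Differentiable ℝ (fderiv ℝ f) := (hs.fderiv_right (m := 1) (by norm_num)).differentiable (by norm_num)
  have key : ∀ i j : Fin 3, pd i (pd j f) x = fderiv ℝ (fderiv ℝ f) x (ee i) (ee j) := by
    intro i j
    unfold pd
    rw [fderiv_clm_apply (h1 x) (differentiableAt_const _)]
    simp
  rw [key, key]
  exact (hs.contDiffAt.isSymmSndFDerivAt (by simp)).eq _ _

lemma schwartz_diff (f : 𝓢(E3, ℝ)) : Differentiable ℝ f := f.differentiable

/-- Integration by parts against a bounded function with bounded derivative. -/
lemma ibp_schwartz (f : 𝓢(E3, ℝ)) (i : Fin 3) {w : E3 → ℝ} (hw : Differentiable ℝ w) {C C' : ℝ}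
    (hC : ∀ x, |w x| ≤ C) (hC' : ∀ x, |pd i w x| ≤ C') (hc : Continuous (pd i w)) :
    ∫ x, f x * pd i w x = - ∫ x, pd i f x * w x := by
  refine integral_mul_fderiv_eq_neg_fderiv_mul_of_integrable (v := ee i) ?_ ?_ ?_
    (fun x _ => f.differentiable x) (fun x _ => hw x)
  · have : Integrable (fun x => spd i f x * w x) :=
      (spd i f).integrable.mul_bdd (c := C) hw.continuous.aestronglyMeasurable
        (Filter.Eventually.of_forall hC)
    rwa [spd_coe] at this
  · exact f.integrable.mul_bdd (c := C') hc.aestronglyMeasurable (Filter.Eventually.of_forall hC')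
  · exact f.integrable.mul_bdd (c := C) hw.continuous.aestronglyMeasurable
        (Filter.Eventually.of_forall hC)

/-- Heat flow commutes with derivatives. -/
lemma cv_comm (f : 𝓢(E3, ℝ)) (i : Fin 3) {t : ℝ} (ht : 0 < t) :
    cv (hk t) (pd i f) = cv (hk1 i t) f := by
  funext x
  have hd : Differentiable ℝ (hk t) := (hk_contDiff t).differentiable (by norm_num)
  have hp : pd i (fun y => hk t (x - y)) = fun y => - hk1 i t (x - y) := by
    funext y
    have h1 : HasFDerivAt (fun y => hk t (x - y)) ((fderiv ℝ (hk t) (x - y)).comp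
        (-ContinuousLinearMap.id ℝ E3)) y :=
      HasFDerivAt.comp y (hd _).hasFDerivAt ((hasFDerivAt_id y).const_sub x)
    unfold pd
    rw [h1.fderiv, ← hk_pd i ht]
    simp [pd]
  have := ibp_schwartz f i (w := fun y => hk t (x - y)) (hd.comp (differentiable_id.const_sub x))
    (C := hbd t) (C' := hbd t) (fun y => hk_le ht le_rfl _)
    (fun y => by rw [hp]; simpa using hk1_le ht le_rfl i (x - y))
    (by rw [hp]; have := (hk1_contDiff i t).continuous; fun_prop)
  rw [hp] at this
  unfold cv
  simp only [mul_neg, integral_neg, neg_inj] at this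
  simp_rw [mul_comm (hk t _), mul_comm (hk1 i t _)]
  exact this.symm

lemma hk_neg (t : ℝ) (z : E3) : hk t (-z) = hk t z := by simp [hk]

lemma tensor_bdd {K : E3 × E3 → ℝ} (hK : Continuous K) {C : ℝ} (hC : ∀ z, |K z| ≤ C)
    {φ ψ : E3 → ℝ} (hφ : Integrable φ) (hψ : Integrable ψ) :
    Integrable (fun z : E3 × E3 => K z * (φ z.1 * ψ z.2)) (volume.prod volume) :=
  (hφ.mul_prod hψ).bdd_mul (c := C) hK.aestronglyMeasurable (Filter.Eventually.of_forall hC)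

lemma cv_symm {t : ℝ} (ht : 0 < t) {φ ψ : E3 → ℝ} (hφ : Integrable φ) (hψ : Integrable ψ) :
    ∫ x, φ x * cv (hk t) ψ x = ∫ x, cv (hk t) φ x * ψ x := by
  have hc := (hk_contDiff t).continuous
  have hi := tensor_bdd (K := fun z => hk t (z.1 - z.2)) (by fun_prop) (C := hbd t)
    (fun z => hk_le ht le_rfl _) hφ hψ
  have := integral_integral_swap (f := fun x y => hk t (x - y) * (φ x * ψ y)) hi
  unfold cv
  calc _ = ∫ x, ∫ y, hk t (x - y) * (φ x * ψ y) := by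
        congr 1; funext x; rw [← integral_const_mul]; congr 1; funext y; ring
    _ = _ := this
    _ = _ := by
        congr 1; funext y; rw [← integral_mul_const]; congr 1; funext x
        rw [← hk_neg, neg_sub]; ring

lemma rpow_aux {A B : ℝ} (hA : 0 < A) (hB : 0 < B) :
    (A * B⁻¹) ^ (-(3/2) : ℝ) = A ^ (-(3/2) : ℝ) * B ^ (3/2 : ℝ) := by
  rw [mul_rpow hA.le (by positivity), inv_rpow hB.le, rpow_neg hB.le, inv_inv]

lemma hk_semi {t : ℝ} (ht : 0 < t) (x z : E3) :
    ∫ y, hk t (x - y) * hk t (y - z) = hk (2 * t) (x - z) := by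
  have e : ∀ y, hk t (x - y) * hk t (y - z) =
      ((4 * π * t) ^ (-(3/2) : ℝ) * (4 * π * t) ^ (-(3/2) : ℝ) * rexp (-(‖x - z‖ ^ 2 / (4 * (2 * t)))))
       * rexp (-(1 / (2 * t)) * ‖y - (1/2 : ℝ) • (x + z)‖ ^ 2) := by
    intro y
    have hp : ‖x - y‖ ^ 2 + ‖y - z‖ ^ 2 = 2 * ‖y - (1/2 : ℝ) • (x + z)‖ ^ 2 + ‖x - z‖ ^ 2 / 2 := by
      simp only [EuclideanSpace.norm_sq_eq, Fin.sum_univ_three, Real.norm_eq_abs, sq_abs]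
      simp
      ring
    unfold hk
    rw [mul_mul_mul_comm, ← exp_add, mul_assoc _ (rexp _) (rexp _), ← exp_add]
    congr 2
    rw [show -(‖x - y‖ ^ 2 / (4 * t)) + -(‖y - z‖ ^ 2 / (4 * t)) =
      -((‖x - y‖ ^ 2 + ‖y - z‖ ^ 2) / (4 * t)) by ring, hp]
    field_simp
    ring
  simp_rw [e]
  rw [integral_const_mul, integral_sub_right_eq_self (fun y => rexp (-(1 / (2 * t)) * ‖y‖ ^ 2)),
    gauss_integral (by positivity)]
  unfold hk
  have : (4 * π * t) ^ (-(3/2) : ℝ) * (4 * π * t) ^ (-(3/2) : ℝ) * (π / (1 / (2 * t))) ^ (3/2 : ℝ) =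
     (4 * π * (2 * t)) ^ (-(3/2) : ℝ) := by
    have hp := pi_pos
    rw [show π / (1 / (2 * t)) = (2 * π * t) by field_simp,
      show 4 * π * (2 * t) = (4 * π * t) * (4 * π * t) * (2 * π * t)⁻¹ by field_simp; ring,
      rpow_aux (by positivity) (by positivity),
      mul_rpow (x := 4 * π * t) (y := 4 * π * t) (by positivity) (by positivity)]
  rw [← this]; ring

lemma cv_semi {t : ℝ} (ht : 0 < t) {g : E3 → ℝ} (hg : Integrable g) :
    cv (hk t) (cv (hk t) g) = cv (hk (2 * t)) g := by
  funext x
  have hc := (hk_contDiff t).continuous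
  have hi := tensor_bdd (K := fun z => hk t (z.1 - z.2)) (by fun_prop) (C := hbd t)
    (fun z => hk_le ht le_rfl _) (hk_integrable_shift ht x) hg
  have := integral_integral_swap (f := fun y z => hk t (y - z) * (hk t (x - y) * g z)) hi
  unfold cv
  calc _ = ∫ y, ∫ z, hk t (y - z) * (hk t (x - y) * g z) := by
        congr 1; funext y; rw [← integral_const_mul]; congr 1; funext z; ring
    _ = _ := this
    _ = _ := by
        congr 1; funext z; rw [← hk_semi ht, ← integral_mul_const]; congr 1; funext y; ring

lemma pair_semi {t : ℝ} (ht : 0 < t) {φ g : E3 → ℝ} (hφ : Integrable φ) (hg : Integrable g) :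
    ∫ x, φ x * cv (hk (2 * t)) g x = ∫ x, cv (hk t) φ x * cv (hk t) g x := by
  rw [← cv_semi ht hg, cv_symm ht hφ (cv_integrable_all (hk_integrable ht) hg)]

lemma approx_id {g : E3 → ℝ} (hg : Integrable g) (hc : Continuous g) (x : E3) :
    Filter.Tendsto (fun c : ℝ => cv (hk (1 / c ^ 2)) g x) Filter.atTop (nhds (g x)) := by
  have hlim : Filter.Tendsto (fun x : E3 => ‖x‖ ^ Module.finrank ℝ E3 * hk 1 x)
      (Bornology.cobounded E3) (nhds 0) := by
    have h1 : Filter.Tendsto (fun r : ℝ => (4 * π * 1) ^ (-(3/2) : ℝ) * (r ^ (3:ℝ) * rexp (-(1/4) * r ^ 2))) Filter.atTop (nhds 0) := by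
      rw [← mul_zero ((4 * π * 1) ^ (-(3/2) : ℝ))]
      refine Filter.Tendsto.const_mul _ ?_
      have := (rpow_mul_exp_neg_mul_sq_isLittleO_exp_neg (b := 1/4) (by norm_num) 3).trans_tendsto ?_
      · exact this
      · exact tendsto_exp_atBot.comp (by
          exact Filter.tendsto_id.const_mul_atTop_of_neg (r := (-(1/2) : ℝ)) (by norm_num))
    have := h1.comp (tendsto_norm_cobounded_atTop (E := E3))
    refine this.congr fun x => ?_
    simp only [Function.comp, hk, finrank_euclideanSpace, Fintype.card_fin]
    norm_num
    rw [show -(1 / 4 * ‖x‖ ^ 2) = -(‖x‖ ^ 2 / 4) by ring]; ring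
  have := tendsto_integral_comp_smul_smul_of_integrable' (μ := (volume : Measure E3)) (φ := hk 1)
    (fun x => (hk_pos one_pos x).le) (hk_integral one_pos) hlim hg (hc.continuousAt (x := x))
  refine this.congr' ?_
  filter_upwards [Filter.eventually_gt_atTop 0] with c hc0
  unfold cv
  congr 1; funext y
  rw [smul_eq_mul]; congr 1
  unfold hk
  rw [norm_smul, Real.norm_of_nonneg hc0.le, finrank_euclideanSpace, Fintype.card_fin, ← mul_assoc]
  congr 1
  · rw [show 4 * π * (1 / c ^ 2) = (4 * π * 1) * (c ^ 2)⁻¹ by ring,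
      rpow_aux (by positivity) (by positivity), ← rpow_natCast c 2, ← rpow_mul hc0.le,
      ← rpow_natCast c 3, mul_comm]
    norm_num
  · congr 1; field_simp

lemma heat_int (a : 𝓢(E3, ℝ)) {g : E3 → ℝ} (hg : Integrable g) {δ t : ℝ} (hδ : 0 < δ) (ht : δ ≤ t) :
    Integrable (fun x => a x * cv (hk t) g x) :=
  a.integrable.mul_bdd (c := hbd δ * ∫ y, |g y|)
    ((heatSol hg).diff t (lt_of_lt_of_le hδ ht)).continuous.aestronglyMeasurable
    (Filter.Eventually.of_forall fun x => cv_bound (hk_le hδ ht) hg x)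

lemma lap_bound {g : E3 → ℝ} (hg : Integrable g) {δ t : ℝ} (hδ : 0 < δ) (ht : δ ≤ t) (x : E3) :
    |∑ i, cv (hk2 i i t) g x| ≤ 3 * (hbd δ * ∫ y, |g y|) := by
  refine (Finset.abs_sum_le_sum_abs _ _).trans ?_
  refine (Finset.sum_le_card_nsmul _ _ _ fun i _ => cv_bound (hk2_le hδ ht i i) hg x).trans ?_
  simp

lemma lap_cont {g : E3 → ℝ} (hg : Integrable g) :
    ContinuousOn (fun z : ℝ × E3 => ∑ i, cv (hk2 i i z.1) g z.2) (Set.Ioi 0 ×ˢ Set.univ) :=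
  continuousOn_finsetSum _ fun i _ => (heatSol hg).cont2 i

lemma J_deriv (a : 𝓢(E3, ℝ)) {g : E3 → ℝ} (hg : Integrable g) {t : ℝ} (ht : 0 < t) :
    HasDerivAt (fun t => ∫ x, a x * cv (hk t) g x) (∫ x, a x * ∑ i, cv (hk2 i i t) g x) t := by
  have hmem : Set.Ioi (t / 2) ∈ nhds t := Ioi_mem_nhds (by linarith)
  have h2 : 0 < t / 2 := by linarith
  refine (hasDerivAt_integral_of_dominated_loc_of_deriv_le (𝕜 := ℝ)
    (F := fun t x => a x * cv (hk t) g x) (F' := fun t x => a x * ∑ i, cv (hk2 i i t) g x)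
    (bound := fun x => |a x| * (3 * (hbd (t / 2) * ∫ y, |g y|))) hmem ?_ ?_ ?_ ?_ ?_ ?_).2
  · filter_upwards [hmem] with r hr
    exact (heat_int a hg h2 (le_of_lt hr)).aestronglyMeasurable
  · exact heat_int a hg h2 (by linarith)
  · exact (a.continuous.mul (contOn_slice (f := fun t x => ∑ i, cv (hk2 i i t) g x)
      (lap_cont hg) ht)).aestronglyMeasurable
  · refine Filter.Eventually.of_forall fun x r hr => ?_
    rw [norm_mul]
    exact mul_le_mul_of_nonneg_left (lap_bound hg h2 (le_of_lt hr) x) (abs_nonneg _)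
  · exact a.integrable.norm.mul_const _
  · refine Filter.Eventually.of_forall fun x r hr => ?_
    exact ((heatSol hg).heat r x (lt_trans h2 hr)).const_mul _

lemma J_deriv_cont (a : 𝓢(E3, ℝ)) {g : E3 → ℝ} (hg : Integrable g) {δ T : ℝ} (hδ : 0 < δ) :
    ContinuousOn (fun t => ∫ x, a x * ∑ i, cv (hk2 i i t) g x) (Set.Icc δ T) := by
  refine continuousOn_of_dominated (bound := fun x => |a x| * (3 * (hbd δ * ∫ y, |g y|))) ?_ ?_ ?_ ?_
  · intro t ht
    exact (a.continuous.mul (contOn_slice (f := fun t x => ∑ i, cv (hk2 i i t) g x)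
      (lap_cont hg) (lt_of_lt_of_le hδ ht.1))).aestronglyMeasurable
  · intro t ht
    refine Filter.Eventually.of_forall fun x => ?_
    rw [norm_mul]
    exact mul_le_mul_of_nonneg_left (lap_bound hg hδ ht.1 x) (abs_nonneg _)
  · exact a.integrable.norm.mul_const _
  · refine Filter.Eventually.of_forall fun x => ?_
    refine continuousOn_const.mul ?_
    exact (lap_cont hg).comp (f := fun t : ℝ => (t, x)) (by fun_prop)
      fun t ht => ⟨lt_of_lt_of_le hδ ht.1, trivial⟩

lemma lap_move (a : 𝓢(E3, ℝ)) {g : E3 → ℝ} (hg : Integrable g) {t : ℝ} (ht : 0 < t) :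
    ∫ x, a x * ∑ i, cv (hk2 i i t) g x = ∫ x, (∑ i, spd i (spd i a) x) * cv (hk t) g x := by
  have H := heatSol hg
  have b0 := cv_bound (hk_le ht le_rfl) hg
  have b1 := fun i => cv_bound (hk1_le ht le_rfl i) hg
  have b2 := fun i => cv_bound (hk2_le ht le_rfl i i) hg
  have c2 : ∀ i, Continuous (cv (hk2 i i t) g) := fun i =>
    contOn_slice (f := fun t => cv (hk2 i i t) g) (H.cont2 i) ht
  have c1 : ∀ i, Continuous (cv (hk1 i t) g) := fun i =>
    contOn_slice (f := fun t => cv (hk1 i t) g) (H.cont1 i) ht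
  simp_rw [Finset.mul_sum, Finset.sum_mul]
  rw [integral_finsetSum, integral_finsetSum]
  · refine Finset.sum_congr rfl fun i _ => ?_
    have e1 := ibp_schwartz a i (H.diff1 i t ht) (b1 i) (C' := hbd t * ∫ y, |g y|)
      (by rw [H.pd2 i t ht]; exact b2 i) (by rw [H.pd2 i t ht]; exact c2 i)
    have e2 := ibp_schwartz (spd i a) i (H.diff t ht) b0 (C' := hbd t * ∫ y, |g y|)
      (by rw [H.pd1 i t ht]; exact b1 i) (by rw [H.pd1 i t ht]; exact c1 i)
    rw [H.pd2 i t ht] at e1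
    rw [H.pd1 i t ht, spd_coe] at e2
    rw [e1, e2, neg_neg, spd_coe, spd_coe]
  · exact fun i _ => heat_int _ hg ht le_rfl
  · exact fun i _ => a.integrable.mul_bdd (c2 i).aestronglyMeasurable
      (Filter.Eventually.of_forall (b2 i))

lemma pair_form (F : 𝓢(E3, ℝ)) {g : E3 → ℝ} (hg : Integrable g) {t : ℝ} (ht : 0 < t) (k j : Fin 3) :
    ∫ x, spd j (spd k F) x * cv (hk (2 * t)) g x
      = - ∫ x, cv (hk1 k t) F x * cv (hk1 j t) g x := by
  have H := heatSol hg
  have HF := heatSol (spd k F).integrable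
  have hki := hk_integrable ht
  rw [pair_semi ht (spd j (spd k F)).integrable hg, spd_coe, cv_comm _ _ ht, ← cv_comm F k ht,
    ← spd_coe k F]
  have b0 := cv_bound (hk_le ht le_rfl) hg
  have b1 := cv_bound (hk1_le ht le_rfl j) hg
  have c1 : Continuous (cv (hk1 j t) g) :=
    contOn_slice (f := fun t => cv (hk1 j t) g) (H.cont1 j) ht
  have c0 := (H.diff t ht).continuous
  have i0 : Integrable (cv (hk t) (spd k F)) := cv_integrable_all hki (spd k F).integrable
  have i1 : Integrable (cv (hk1 j t) (spd k F)) := by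
    rw [← cv_comm _ _ ht, ← spd_coe]
    exact cv_integrable_all hki (spd j (spd k F)).integrable
  have := integral_mul_fderiv_eq_neg_fderiv_mul_of_integrable (v := ee j) (μ := volume)
    (f := cv (hk t) (spd k F)) (g := cv (hk t) g) ?_ ?_ ?_ (fun x _ => HF.diff t ht x)
    (fun x _ => H.diff t ht x)
  · change ∫ x, _ * pd j _ x = - ∫ x, pd j _ x * _ at this
    rw [H.pd1 j t ht, HF.pd1 j t ht] at this
    rw [this, neg_neg]
  · change Integrable fun x => pd j _ x * _
    rw [HF.pd1 j t ht]
    exact i1.mul_bdd c0.aestronglyMeasurable (Filter.Eventually.of_forall b0)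
  · change Integrable fun x => _ * pd j _ x
    rw [H.pd1 j t ht]
    exact i0.mul_bdd c1.aestronglyMeasurable (Filter.Eventually.of_forall b1)
  · exact i0.mul_bdd c0.aestronglyMeasurable (Filter.Eventually.of_forall b0)

lemma pd_sum3 (F : Fin 3 → 𝓢(E3, ℝ)) (j : Fin 3) (x : E3) :
    pd j (fun y => ∑ k, F k y) x = ∑ k, pd j (F k) x := by
  unfold pd
  rw [fderiv_fun_sum fun k _ => (F k).differentiable x]
  simp

lemma lap_eq (h : 𝓢(E3, ℝ)) (F : Fin 3 → 𝓢(E3, ℝ))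
    (hΔ : ∀ x, ∑ i, pd i (pd i h) x = ∑ k, pd k (F k) x) (j : Fin 3) (x : E3) :
    ∑ i, spd i (spd i (spd j h)) x = ∑ k, spd j (spd k (F k)) x := by
  have e : ∀ i, spd i (spd i (spd j h)) = spd j (spd i (spd i h)) := by
    intro i
    have c : ∀ f, spd i (spd j f) = spd j (spd i f) := fun f => by
      ext y; rw [spd_coe, spd_coe, spd_coe, spd_coe]; exact pd_comm i j f y
    rw [c, c]
  simp_rw [e]
  have h1 := pd_sum3 (fun i => spd i (spd i h)) j x
  have h2 := pd_sum3 (fun k => spd k (F k)) j x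
  simp_rw [spd_coe j]
  rw [← h1, ← h2]
  congr 1; funext y; simp_rw [spd_coe]; exact hΔ y

lemma J_deriv_bound (h : 𝓢(E3, ℝ)) (F : Fin 3 → 𝓢(E3, ℝ))
    (hΔ : ∀ x, ∑ i, pd i (pd i h) x = ∑ k, pd k (F k) x) (j : Fin 3) {g : E3 → ℝ}
    (hg : Integrable g) {t : ℝ} (ht : 0 < t) :
    ‖∫ x, spd j h x * ∑ i, cv (hk2 i i (2 * t)) g x‖ₑ ≤
      ∑ k, ∫⁻ x, ENNReal.ofReal (|cv (hk1 k t) (F k) x| * |cv (hk1 j t) g x|) := by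
  have h2 : 0 < 2 * t := by linarith
  rw [lap_move _ hg h2]
  simp_rw [lap_eq h F hΔ j, Finset.sum_mul]
  rw [integral_finsetSum _ fun i _ => heat_int _ hg h2 le_rfl]
  refine (enorm_sum_le _ _).trans (Finset.sum_le_sum fun k _ => ?_)
  rw [pair_form _ hg ht, enorm_neg]
  refine (enorm_integral_le_lintegral_enorm _).trans (le_of_eq ?_)
  congr 1; funext x
  rw [← abs_mul, Real.enorm_eq_ofReal_abs]

lemma J_diff (h : 𝓢(E3, ℝ)) (F : Fin 3 → 𝓢(E3, ℝ))
    (hΔ : ∀ x, ∑ i, pd i (pd i h) x = ∑ k, pd k (F k) x) (j : Fin 3) {g : E3 → ℝ}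
    (hg : Integrable g) {C : ℝ} (hC : 0 ≤ C)
    (hB : ∀ k δ T, 0 < δ → δ ≤ T → ∫⁻ t in Set.Ioc δ T, ∫⁻ x,
      ENNReal.ofReal (|cv (hk1 k t) (F k) x| * |cv (hk1 j t) g x|) ≤ ENNReal.ofReal C)
    {δ T : ℝ} (hδ : 0 < δ) (hT : δ ≤ T) :
    |(∫ x, spd j h x * cv (hk (2 * T)) g x) - ∫ x, spd j h x * cv (hk (2 * δ)) g x| ≤ 6 * C := by
  set D : ℝ → ℝ := fun t => ∫ x, spd j h x * ∑ i, cv (hk2 i i t) g x with hD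
  have hder : ∀ t ∈ Set.uIcc δ T, HasDerivAt (fun t => ∫ x, spd j h x * cv (hk (2 * t)) g x)
      (D (2 * t) * 2) t := by
    intro t ht
    rw [Set.uIcc_of_le hT] at ht
    have h2 : 0 < 2 * t := by linarith [ht.1]
    have h3 : HasDerivAt (fun t : ℝ => 2 * t) 2 t := by
      simpa using (hasDerivAt_id t).const_mul 2
    exact HasDerivAt.comp t (J_deriv (spd j h) hg h2) h3
  have hcont : ContinuousOn (fun t => D (2 * t) * 2) (Set.uIcc δ T) := by
    rw [Set.uIcc_of_le hT]
    refine ContinuousOn.mul ?_ continuousOn_const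
    exact (J_deriv_cont (spd j h) hg (δ := 2 * δ) (T := 2 * T) (by linarith)).comp
      (f := fun t : ℝ => 2 * t) (by fun_prop)
      fun t ht => ⟨by linarith [ht.1], by linarith [ht.2]⟩
  have key := intervalIntegral.integral_eq_sub_of_hasDerivAt hder hcont.intervalIntegrable
  rw [← key, intervalIntegral.integral_of_le hT]
  have h6 : ‖∫ t in Set.Ioc δ T, D (2 * t) * 2‖ₑ ≤ ENNReal.ofReal (6 * C) := by
    refine (enorm_integral_le_lintegral_enorm _).trans ?_
    calc ∫⁻ t in Set.Ioc δ T, ‖D (2 * t) * 2‖ₑ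
        ≤ ∫⁻ t in Set.Ioc δ T, 2 * ∑ k, ∫⁻ x,
          ENNReal.ofReal (|cv (hk1 k t) (F k) x| * |cv (hk1 j t) g x|) := by
          refine lintegral_mono_ae ?_
          filter_upwards [ae_restrict_mem measurableSet_Ioc] with t ht
          rw [enorm_mul, mul_comm]
          have : ‖(2:ℝ)‖ₑ = 2 := by simp [Real.enorm_eq_ofReal_abs]
          rw [this]
          gcongr
          exact J_deriv_bound h F hΔ j hg (lt_trans hδ ht.1)
      _ = 2 * ∑ k, ∫⁻ t in Set.Ioc δ T, ∫⁻ x,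
          ENNReal.ofReal (|cv (hk1 k t) (F k) x| * |cv (hk1 j t) g x|) := by
          rw [lintegral_const_mul' _ _ (by simp), lintegral_finsetSum']
          intro k _
          exact aemeas_slab (F := fun t x => |cv (hk1 k t) (F k) x| * |cv (hk1 j t) g x|)
            (((heatSol (F k).integrable).cont1 k).abs.mul ((heatSol hg).cont1 j).abs) hδ
      _ ≤ 2 * ∑ k : Fin 3, ENNReal.ofReal C := by
          gcongr with k _
          exact hB k δ T hδ hT
      _ = ENNReal.ofReal (6 * C) := by
          rw [ENNReal.ofReal_mul (by norm_num)]
          simp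
          rw [← mul_assoc]; norm_num
  rwa [Real.enorm_eq_ofReal_abs, ENNReal.ofReal_le_ofReal_iff (by positivity)] at h6

lemma dual_bound (h : 𝓢(E3, ℝ)) (F : Fin 3 → 𝓢(E3, ℝ))
    (hΔ : ∀ x, ∑ i, pd i (pd i h) x = ∑ k, pd k (F k) x) (j : Fin 3) {g : E3 → ℝ}
    (hg : Integrable g) (hgc : Continuous g) {B : ℝ} (hgB : ∀ x, |g x| ≤ B) {C : ℝ} (hC : 0 ≤ C)
    (hB : ∀ k δ T, 0 < δ → δ ≤ T → ∫⁻ t in Set.Ioc δ T, ∫⁻ x,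
      ENNReal.ofReal (|cv (hk1 k t) (F k) x| * |cv (hk1 j t) g x|) ≤ ENNReal.ofReal C) :
    |∫ x, spd j h x * g x| ≤ 6 * C := by
  set J : ℝ → ℝ := fun t => ∫ x, spd j h x * cv (hk t) g x with hJ
  have hd : ∀ δ T, 0 < δ → δ ≤ T → |J T - J δ| ≤ 6 * C := by
    intro δ T hδ hT
    have := J_diff h F hΔ j hg hC hB (δ := δ / 2) (T := T / 2) (by linarith) (by linarith)
    rwa [mul_div_cancel₀ _ (by norm_num : (2:ℝ) ≠ 0), mul_div_cancel₀ _ (by norm_num : (2:ℝ) ≠ 0)] at this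
  have hinf : Filter.Tendsto J Filter.atTop (nhds 0) := by
    have hb : ∀ t, 0 < t → |J t| ≤ hbd t * ((∫ y, |g y|) * ∫ x, |spd j h x|) := by
      intro t ht
      rw [hJ, ← mul_assoc, ← integral_const_mul, ← Real.norm_eq_abs]
      refine norm_integral_le_of_norm_le ((spd j h).integrable.norm.const_mul _)
        (Filter.Eventually.of_forall fun x => ?_)
      rw [norm_mul, mul_comm]
      exact mul_le_mul_of_nonneg_right (cv_bound (hk_le ht le_rfl) hg x) (norm_nonneg _)
    have hl : Filter.Tendsto hbd Filter.atTop (nhds 0) := by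
      have h1 : Filter.Tendsto (fun t : ℝ => 1 + 1 / t) Filter.atTop (nhds (1 + 0)) :=
        tendsto_const_nhds.add (tendsto_const_nhds.div_atTop Filter.tendsto_id)
      have h2 : Filter.Tendsto (fun t : ℝ => (4 * π * t) ^ (-(3/2) : ℝ)) Filter.atTop (nhds 0) :=
        (tendsto_rpow_neg_atTop (by norm_num : (0:ℝ) < 3/2)).comp
          (Filter.tendsto_id.const_mul_atTop (by positivity))
      have h3 := h1.mul h2
      rw [mul_zero] at h3
      exact h3
    refine squeeze_zero_norm' ?_ (by simpa using hl.mul_const ((∫ y, |g y|) * ∫ x, |spd j h x|))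
    filter_upwards [Filter.eventually_gt_atTop 0] with t ht using hb t ht
  have hδ : ∀ δ, 0 < δ → |J δ| ≤ 6 * C := by
    intro δ hδ
    have : Filter.Tendsto (fun T => |J T - J δ|) Filter.atTop (nhds |0 - J δ|) :=
      (hinf.sub_const _).abs
    rw [zero_sub, abs_neg] at this
    refine le_of_tendsto this ?_
    filter_upwards [Filter.eventually_ge_atTop δ] with T hT using hd δ T hδ hT
  have h0 : Filter.Tendsto (fun c : ℝ => J (1 / c ^ 2)) Filter.atTop
      (nhds (∫ x, spd j h x * g x)) := by
    refine tendsto_integral_filter_of_dominated_convergence (fun x => |spd j h x| * B) ?_ ?_ ?_ ?_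
    · filter_upwards [Filter.eventually_gt_atTop 0] with c hc
      have : 0 < 1 / c ^ 2 := by positivity
      exact (heat_int (spd j h) hg this le_rfl).aestronglyMeasurable
    · filter_upwards [Filter.eventually_gt_atTop 0] with c hc
      have : 0 < 1 / c ^ 2 := by positivity
      refine Filter.Eventually.of_forall fun x => ?_
      rw [norm_mul]
      refine mul_le_mul_of_nonneg_left ?_ (norm_nonneg _)
      unfold cv
      have h1 := hk_integrable_shift this x
      calc _ ≤ ∫ y, hk (1 / c ^ 2) (x - y) * B := by
            refine norm_integral_le_of_norm_le (h1.mul_const B) (Filter.Eventually.of_forall fun y => ?_)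
            rw [norm_mul, Real.norm_of_nonneg (hk_pos this _).le]
            exact mul_le_mul_of_nonneg_left (hgB y) (hk_pos this _).le
        _ = B := by rw [integral_mul_const, hk_integral_shift this, one_mul]
    · exact (spd j h).integrable.norm.mul_const _
    · exact Filter.Eventually.of_forall fun x => (approx_id hg hgc x).const_mul _
  refine le_of_tendsto h0.abs ?_
  filter_upwards [Filter.eventually_gt_atTop 0] with c hc
  exact hδ _ (by positivity)

lemma sch_pow (f : 𝓢(E3, ℝ)) {p : ℝ} (hp : 0 < p) : Integrable (fun x => |f x| ^ p) := by
  have := (f.memLp (ENNReal.ofReal p) (μ := volume)).integrable_norm_rpow (by simpa using hp) (by simp)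
  simpa [ENNReal.toReal_ofReal hp.le] using this

lemma riesz_normed {r : ℝ} (hr : 1 < r) : ∃ C : ℝ, 0 ≤ C ∧ ∀ (h : 𝓢(E3, ℝ)) (F : Fin 3 → 𝓢(E3, ℝ)),
    (∀ x, ∑ i, pd i (pd i h) x = ∑ k, pd k (F k) x) → ∀ (j : Fin 3) (g : E3 → ℝ),
    Continuous g → (∃ B, ∀ x, |g x| ≤ B) → (∀ p : ℝ, 0 < p → Integrable (fun x => |g x| ^ p)) →
    ∫ x, |g x| ^ (r / (r - 1)) ≤ 1 → (∀ k, ∫ x, |F k x| ^ r ≤ 1) →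
    |∫ x, spd j h x * g x| ≤ C := by
  have hr1 : 0 < r - 1 := by linarith
  rcases le_total 2 r with h2 | h2
  · obtain ⟨C, hC, H⟩ := embed2 (s := 2 - r / (r - 1))
      (by rw [sub_nonneg, div_le_iff₀ hr1]; linarith)
      (by
        have : 1 < r / (r - 1) := by rw [lt_div_iff₀ hr1]; linarith
        linarith)
    refine ⟨6 * C, by positivity, fun h F hΔ j g hc ⟨B, hB⟩ hp hg hF => ?_⟩
    have e1 : 2 - (2 - r / (r - 1)) = r / (r - 1) := by ring
    have e2 : 1 - (2 - r / (r - 1)) = 1 / (r - 1) := by field_simp; ring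
    have e3 : r / (r - 1) / (1 / (r - 1)) = r := by field_simp
    have e4 : 1 / (1 / (r - 1)) = r - 1 := by field_simp
    rw [e1, e2, e3, e4] at H
    have hgi : Integrable g := by
      have := hp 1 one_pos
      simp_rw [rpow_one] at this
      exact (integrable_norm_iff hc.aestronglyMeasurable).1 this
    refine dual_bound h F hΔ j hgi hc hB hC fun k δ T hδ hT => ?_
    exact H (F k) g (F k).integrable hgi (sch_pow _ hr1) (sch_pow _ (by linarith))
      (hp _ (by positivity)) (hF k) hg k j δ T hδ hT
  · obtain ⟨C, hC, H⟩ := embed2 (s := 2 - r) (by linarith) (by linarith)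
    refine ⟨6 * C, by positivity, fun h F hΔ j g hc ⟨B, hB⟩ hp hg hF => ?_⟩
    have e1 : 2 - (2 - r) = r := by ring
    have e2 : 1 - (2 - r) = r - 1 := by ring
    rw [e1, e2] at H
    have hgi : Integrable g := by
      have := hp 1 one_pos
      simp_rw [rpow_one] at this
      exact (integrable_norm_iff hc.aestronglyMeasurable).1 this
    refine dual_bound h F hΔ j hgi hc hB hC fun k δ T hδ hT => ?_
    have := H g (F k) hgi (F k).integrable (hp _ (by positivity)) (hp _ (by positivity))
      (sch_pow _ (by linarith)) hg (hF k) j k δ T hδ hT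
    simp_rw [mul_comm |cv (hk1 j _) g _|] at this
    exact this

/-- The duality function `sign(y)|y|^p`. -/
def sp (p y : ℝ) : ℝ := (max y 0) ^ p - (max (-y) 0) ^ p

lemma sp_cont {p : ℝ} (hp : 0 ≤ p) : Continuous (sp p) := by
  unfold sp
  exact ((continuous_id.max continuous_const).rpow_const fun _ => Or.inr hp).sub
    ((continuous_neg.max continuous_const).rpow_const fun _ => Or.inr hp)

lemma sp_abs {p : ℝ} (hp : 0 < p) (y : ℝ) : |sp p y| = |y| ^ p := by
  unfold sp
  rcases le_total 0 y with h | h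
  · rw [max_eq_left h, max_eq_right (by linarith), zero_rpow hp.ne', sub_zero, abs_of_nonneg h,
      abs_of_nonneg (rpow_nonneg h _)]
  · rw [max_eq_right h, max_eq_left (by linarith), zero_rpow hp.ne', zero_sub, abs_neg,
      abs_of_nonpos h, abs_of_nonneg (rpow_nonneg (by linarith) _)]

lemma sp_mul {p : ℝ} (hp : 0 < p) (y : ℝ) : y * sp p y = |y| ^ (p + 1) := by
  unfold sp
  rcases le_total 0 y with h | h
  · rw [max_eq_left h, max_eq_right (by linarith), zero_rpow hp.ne', sub_zero, abs_of_nonneg h,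
      rpow_add_one' h (by linarith), mul_comm]
  · rw [max_eq_right h, max_eq_left (by linarith), zero_rpow hp.ne', zero_sub,
      abs_of_nonpos h, rpow_add_one' (by linarith) (by linarith)]
    ring

lemma spd_smul (i : Fin 3) (c : ℝ) (f : 𝓢(E3, ℝ)) : spd i (c • f) = c • spd i f := by
  simp [spd]

/-- The `L^r` norm of a scalar function. -/
def nr (r : ℝ) (f : E3 → ℝ) : ℝ := (eLpNorm f (ENNReal.ofReal r) volume).toReal

lemma nr_eq {r : ℝ} (hr : 0 < r) (f : 𝓢(E3, ℝ)) : nr r f = (∫ x, |f x| ^ r) ^ r⁻¹ := by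
  unfold nr
  rw [(f.memLp (ENNReal.ofReal r) (μ := volume)).eLpNorm_eq_integral_rpow_norm (by simpa using hr) (by simp),
    ENNReal.toReal_ofReal hr.le, ENNReal.toReal_ofReal (by positivity)]
  rfl

lemma riesz_pos {r : ℝ} (hr : 1 < r) : ∃ C : ℝ, 0 ≤ C ∧ ∀ (h : 𝓢(E3, ℝ)) (F : Fin 3 → 𝓢(E3, ℝ)),
    (∀ x, ∑ i, pd i (pd i h) x = ∑ k, pd k (F k) x) → ∀ (j : Fin 3) (M : ℝ), 0 < M →
    (∀ k, ∫ x, |F k x| ^ r ≤ M ^ r) → (∫ x, |spd j h x| ^ r) ^ r⁻¹ ≤ C * M := by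
  obtain ⟨C, hC, H⟩ := riesz_normed hr
  refine ⟨C, hC, fun h F hΔ j M hM hF => ?_⟩
  have hr1 : 0 < r - 1 := by linarith
  have hr0 : 0 < r := by linarith
  set a := spd j h with ha
  set A := ∫ x, |a x| ^ r with hA
  have hA0 : 0 ≤ A := integral_nonneg fun x => by positivity
  rcases hA0.eq_or_lt with h0 | h0
  · rw [← h0, zero_rpow (by positivity)]; positivity
  set c := A ^ (-((r - 1) / r)) with hc
  have hc0 : 0 < c := rpow_pos_of_pos h0 _
  have habs : ∀ x, |c * sp (r - 1) (a x)| = c * |a x| ^ (r - 1) := fun x => by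
    rw [abs_mul, abs_of_pos hc0, sp_abs hr1]
  have hpow : ∀ (p : ℝ) x, |c * sp (r - 1) (a x)| ^ p = c ^ p * |a x| ^ ((r - 1) * p) := fun p x => by
    rw [habs, mul_rpow hc0.le (by positivity), ← rpow_mul (abs_nonneg _)]
  have hMi : 0 < M⁻¹ := by positivity
  have key := H (M⁻¹ • h) (fun k => M⁻¹ • F k) ?_ j (fun x => c * sp (r - 1) (a x)) ?_ ?_ ?_ ?_ ?_
  · rw [spd_smul] at key
    have e : ∀ x, (M⁻¹ • spd j h) x * (c * sp (r - 1) (a x)) = (M⁻¹ * c) * |a x| ^ r := by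
      intro x
      have := sp_mul hr1 (a x)
      rw [sub_add_cancel] at this
      rw [← this, _root_.smul_apply, smul_eq_mul]; ring
    simp_rw [e] at key
    rw [integral_const_mul, ← hA, abs_of_nonneg (by positivity)] at key
    have e2 : c * A = A ^ r⁻¹ := by
      rw [hc]
      nth_rewrite 2 [← rpow_one A]
      rw [← rpow_add h0]; congr 1; field_simp; ring
    rw [mul_assoc, e2, inv_mul_le_iff₀ hM] at key
    linarith
  · intro x
    simp_rw [← spd_coe, spd_smul, _root_.smul_apply, ← Finset.smul_sum]
    have := hΔ x
    simp_rw [← spd_coe] at this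
    rw [this]
  · exact continuous_const.mul ((sp_cont hr1.le).comp a.continuous)
  · obtain ⟨B, hB⟩ := a.decay 0 0
    refine ⟨c * B ^ (r - 1), fun x => ?_⟩
    rw [habs]
    have : |a x| ≤ B := by simpa using hB.2 x
    gcongr
  · intro p hp
    simp_rw [hpow]
    exact (sch_pow a (by positivity)).const_mul _
  · simp_rw [hpow]
    rw [integral_const_mul, show (r - 1) * (r / (r - 1)) = r by field_simp, ← hA, hc,
      ← rpow_mul h0.le, show -((r - 1) / r) * (r / (r - 1)) = -1 by field_simp, rpow_neg_one,
      inv_mul_cancel₀ h0.ne']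
  · intro k
    have e : ∀ x, |(M⁻¹ • F k) x| ^ r = (M ^ r)⁻¹ * |F k x| ^ r := by
      intro x
      rw [_root_.smul_apply, smul_eq_mul, abs_mul, abs_of_pos hMi,
        mul_rpow hMi.le (abs_nonneg _), inv_rpow hM.le]
    simp_rw [e]
    rw [integral_const_mul, inv_mul_le_iff₀ (by positivity), mul_one]
    exact hF k

/-- The Riesz transform estimate. -/
lemma riesz {r : ℝ} (hr : 1 < r) : ∃ C : ℝ, 0 ≤ C ∧ ∀ (h : 𝓢(E3, ℝ)) (F : Fin 3 → 𝓢(E3, ℝ)),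
    (∀ x, ∑ i, pd i (pd i h) x = ∑ k, pd k (F k) x) → ∀ (j : Fin 3) (W : ℝ),
    (∀ k, nr r (F k) ≤ W) → nr r (pd j h) ≤ C * W := by
  obtain ⟨C, hC, H⟩ := riesz_pos hr
  refine ⟨C, hC, fun h F hΔ j W hW => ?_⟩
  have hr0 : 0 < r := by linarith
  have hW0 : 0 ≤ W := le_trans ENNReal.toReal_nonneg (hW 0)
  have hM : ∀ ε, 0 < ε → nr r (pd j h) ≤ C * (W + ε) := by
    intro ε hε
    rw [← spd_coe, nr_eq hr0]
    refine H h F hΔ j (W + ε) (by linarith) fun k => ?_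
    have h1 := hW k
    rw [nr_eq hr0] at h1
    have hn : 0 ≤ ∫ x, |F k x| ^ r := integral_nonneg fun x => by positivity
    have h2 := rpow_le_rpow (by positivity) (h1.trans (by linarith : W ≤ W + ε)) hr0.le
    rwa [← rpow_mul hn, inv_mul_cancel₀ hr0.ne', rpow_one] at h2
  have hl : Filter.Tendsto (fun ε : ℝ => C * (W + ε)) (nhdsWithin 0 (Set.Ioi 0)) (nhds (C * (W + 0))) :=
    ((continuous_const.mul (continuous_const.add continuous_id)).tendsto 0).mono_left nhdsWithin_le_nhds
  rw [add_zero] at hl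
  refine ge_of_tendsto hl ?_
  filter_upwards [self_mem_nhdsWithin] with ε hε using hM ε hε

/-- A vector field assembled from its components. -/
def vecf (v : Fin 3 → E3 → ℝ) (x : E3) : E3 :=
  (EuclideanSpace.equiv (Fin 3) ℝ).symm (fun i => v i x)

lemma lqV_eq (q : ℝ) (v : Fin 3 → E3 → ℝ) :
    lqV q v = (eLpNorm (vecf v) (ENNReal.ofReal q) volume).toReal := rfl

lemma vecf_apply (v : Fin 3 → E3 → ℝ) (x : E3) (i : Fin 3) : vecf v x i = v i x := rfl

lemma norm_le_sum (y : E3) : ‖y‖ ≤ |y 0| + |y 1| + |y 2| := by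
  rw [EuclideanSpace.norm_eq, Fin.sum_univ_three]
  refine sqrt_le_iff.2 ⟨by positivity, ?_⟩
  simp only [Real.norm_eq_abs]
  have := abs_nonneg (y 0); have := abs_nonneg (y 1); have := abs_nonneg (y 2)
  nlinarith [mul_nonneg ‹0 ≤ |y 0|› ‹0 ≤ |y 1|›, mul_nonneg ‹0 ≤ |y 0|› ‹0 ≤ |y 2|›,
    mul_nonneg ‹0 ≤ |y 1|› ‹0 ≤ |y 2|›]

lemma vecf_cont {v : Fin 3 → E3 → ℝ} (h : ∀ i, Continuous (v i)) : Continuous (vecf v) :=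
  (EuclideanSpace.equiv (Fin 3) ℝ).symm.continuous.comp (continuous_pi h)

lemma vecf_memLp (q : ℝ) (v : Fin 3 → 𝓢(E3, ℝ)) :
    MemLp (vecf fun i => v i) (ENNReal.ofReal q) volume := by
  have hm : ∀ i, MemLp (fun x => |v i x|) (ENNReal.ofReal q) volume := fun i =>
    ((v i).memLp (ENNReal.ofReal q)).norm
  refine (((hm 0).add (hm 1)).add (hm 2)).mono
    (vecf_cont fun i => (v i).continuous).aestronglyMeasurable
    (Filter.Eventually.of_forall fun x => (norm_le_sum _).trans ?_)
  exact le_abs_self _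

lemma nr_le_lqV (q : ℝ) (v : Fin 3 → 𝓢(E3, ℝ)) {f : E3 → ℝ}
    (hf : ∀ x, |f x| ≤ ‖vecf (fun i => v i) x‖) :
    nr q f ≤ lqV q (fun i => v i) := by
  rw [lqV_eq]
  refine ENNReal.toReal_mono (vecf_memLp q v).2.ne ?_
  exact eLpNorm_mono hf

lemma lqV_tri {q : ℝ} (hq : 1 ≤ q) (v w p : Fin 3 → 𝓢(E3, ℝ))
    (h : ∀ x, ‖vecf (fun i => v i) x‖ ≤ ‖vecf (fun i => w i) x‖ + 2 * (|p 0 x| + |p 1 x| + |p 2 x|)) :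
    lqV q (fun i => v i) ≤ lqV q (fun i => w i) + 2 * (nr q (p 0) + nr q (p 1) + nr q (p 2)) := by
  set Q := ENNReal.ofReal q with hQ
  have hQ1 : 1 ≤ Q := by rw [hQ, ← ENNReal.ofReal_one]; exact ENNReal.ofReal_le_ofReal hq
  have hm : ∀ i, MemLp (fun x => |p i x|) Q volume := fun i => ((p i).memLp Q).norm
  have he : ∀ i, eLpNorm (fun x => |p i x|) Q volume = eLpNorm (p i) Q volume := fun i =>
    eLpNorm_norm (p i)
  have hw := (vecf_memLp q w).norm
  have m01 : MemLp (fun x => |p 0 x| + |p 1 x|) Q volume := (hm 0).add (hm 1)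
  have m012 : MemLp (fun x => |p 0 x| + |p 1 x| + |p 2 x|) Q volume := m01.add (hm 2)
  have m2 : MemLp (fun x => 2 * (|p 0 x| + |p 1 x| + |p 2 x|)) Q volume := m012.const_mul 2
  have key : eLpNorm (vecf fun i => v i) Q volume ≤ eLpNorm (vecf fun i => w i) Q volume +
      2 * (eLpNorm (p 0) Q volume + eLpNorm (p 1) Q volume + eLpNorm (p 2) Q volume) := by
    calc eLpNorm (vecf fun i => v i) Q volume
        ≤ eLpNorm (fun x => ‖vecf (fun i => w i) x‖ + 2 * (|p 0 x| + |p 1 x| + |p 2 x|)) Q volume :=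
          eLpNorm_mono_real h
      _ ≤ eLpNorm (fun x => ‖vecf (fun i => w i) x‖) Q volume +
          eLpNorm (fun x => 2 * (|p 0 x| + |p 1 x| + |p 2 x|)) Q volume :=
          eLpNorm_add_le hw.1 m2.1 hQ1
      _ ≤ _ := by
          rw [eLpNorm_norm]
          gcongr
          have e : eLpNorm (fun x => 2 * (|p 0 x| + |p 1 x| + |p 2 x|)) Q volume =
              2 * eLpNorm (fun x => |p 0 x| + |p 1 x| + |p 2 x|) Q volume := by
            have := eLpNorm_const_smul (2:ℝ) (fun x => |p 0 x| + |p 1 x| + |p 2 x|) Q volume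
            rw [show ‖(2:ℝ)‖ₑ = 2 by simp [Real.enorm_eq_ofReal_abs]] at this
            exact this
          rw [e]
          gcongr
          refine (eLpNorm_add_le m01.1 (hm 2).1 hQ1).trans ?_
          refine add_le_add ((eLpNorm_add_le (hm 0).1 (hm 1).1 hQ1).trans ?_) ?_
          · rw [he 0, he 1]
          · rw [he 2]
  have hf : ∀ i, eLpNorm (p i) Q volume ≠ ⊤ := fun i =>
    ((p i).memLp Q (μ := volume)).eLpNorm_ne_top
  have hwf : eLpNorm (vecf fun i => w i) Q volume ≠ ⊤ := (vecf_memLp q w).2.ne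
  have h01 := ENNReal.add_ne_top.2 ⟨hf 0, hf 1⟩
  have h012 := ENNReal.add_ne_top.2 ⟨h01, hf 2⟩
  have h2 : 2 * (eLpNorm (p 0) Q volume + eLpNorm (p 1) Q volume + eLpNorm (p 2) Q volume) ≠ ⊤ :=
    ENNReal.mul_ne_top ENNReal.ofNat_ne_top h012
  have h3 := ENNReal.toReal_mono (ENNReal.add_ne_top.2 ⟨hwf, h2⟩) key
  rw [ENNReal.toReal_add hwf h2, ENNReal.toReal_mul, ENNReal.toReal_add h01 (hf 2),
    ENNReal.toReal_add (hf 0) (hf 1), ENNReal.toReal_ofNat] at h3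
  rw [lqV_eq, lqV_eq]
  unfold nr
  rw [← hQ]
  exact h3

lemma statement_aux (q : ℝ) (hq : 1 < q) :
    ∃ C : ℝ, 1 ≤ C ∧ ∀ u : Fin 3 → 𝓢(E3, ℝ),
      (∀ x : E3, ∑ i, pd i (⇑(u i)) x = 0) →
      ∀ (ω : Fin 3 → E3 → ℝ), ω = curl (fun i => ⇑(u i)) →
      ∀ (ωh : Fin 3 → E3 → ℝ), ωh = ![ω 0, ω 1, fun _ => 0] →
      ∀ (v3 : Fin 3 → E3 → ℝ), v3 = (fun j x => pd 2 (⇑(u j)) x + pd j (⇑(u 2)) x) →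
      (1 / C) * lqV q ωh ≤ lqV q v3 ∧ lqV q v3 ≤ C * lqV q ωh := by
  obtain ⟨C, hC, H⟩ := riesz hq
  refine ⟨1 + 6 * C, by linarith, ?_⟩
  intro u hdiv ω hω ωh hωh v3 hv3
  set w : Fin 3 → 𝓢(E3, ℝ) := ![spd 1 (u 2) - spd 2 (u 1), spd 2 (u 0) - spd 0 (u 2), 0] with hw
  set v : Fin 3 → 𝓢(E3, ℝ) := fun j => spd 2 (u j) + spd j (u 2) with hv
  set G : Fin 3 → 𝓢(E3, ℝ) := fun j => spd j (u 2) with hG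
  have ew : ωh = fun i => ⇑(w i) := by
    rw [hωh, hω]
    funext i x
    fin_cases i <;> simp [curl, hw, spd_coe]
  have ev : v3 = fun i => ⇑(v i) := by
    rw [hv3]
    funext i x
    simp [hv, spd_coe]
  have hsub : ∀ i f g, spd i (f - g) = spd i f - spd i g := fun i f g => by simp [spd]
  have hadd : ∀ i f g, spd i (f + g) = spd i f + spd i g := fun i f g => by simp [spd]
  have hcm : ∀ i j f, spd i (spd j f) = spd j (spd i f) := fun i j f => by
    ext y; rw [spd_coe, spd_coe, spd_coe, spd_coe]; exact pd_comm i j f y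
  have hdivS : spd 0 (u 0) + spd 1 (u 1) + spd 2 (u 2) = 0 := by
    ext x
    have := hdiv x
    rw [Fin.sum_univ_three] at this
    simpa [spd_coe] using this
  have hd2 : spd 2 (spd 0 (u 0)) + spd 2 (spd 1 (u 1)) + spd 2 (spd 2 (u 2)) = 0 := by
    rw [← hadd, ← hadd, hdivS]; simp [spd]
  have hd2x : ∀ x, spd 2 (spd 0 (u 0)) x + spd 2 (spd 1 (u 1)) x + spd 2 (spd 2 (u 2)) x = 0 := by
    intro x
    have := congrArg (fun f : 𝓢(E3, ℝ) => f x) hd2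
    simpa using this
  have hL : ∀ x, ∑ i, pd i (pd i (u 2)) x =
      spd 0 (spd 0 (u 2)) x + spd 1 (spd 1 (u 2)) x + spd 2 (spd 2 (u 2)) x := by
    intro x; simp_rw [← spd_coe]; rw [Fin.sum_univ_three]
  have H1 := H (u 2) ![- w 1, w 0, 0] (by
    intro x
    rw [hL, Fin.sum_univ_three, ← spd_coe, ← spd_coe, ← spd_coe]
    have h3 := hd2x x
    rw [hcm 2 0, hcm 2 1] at h3
    have hz : ∀ i, spd i 0 = 0 := fun i => by simp [spd]
    simp only [hw, Matrix.cons_val_zero, Matrix.cons_val_one, Matrix.cons_val, hsub, hz,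
      neg_sub]
    simp only [_root_.sub_apply, _root_.zero_apply]
    linarith)
  have H2 := H (u 2) v (by
    intro x
    rw [hL, Fin.sum_univ_three, ← spd_coe, ← spd_coe, ← spd_coe]
    have h3 := hd2x x
    rw [hcm 2 0, hcm 2 1] at h3
    simp only [hv, hadd]
    simp only [_root_.add_apply]
    linarith)
  have co : ∀ (X : Fin 3 → 𝓢(E3, ℝ)) i x, |X i x| ≤ ‖vecf (fun i => X i) x‖ := fun X i x =>
    abs_coord_le (vecf (fun i => X i) x) i
  have B1 := fun j => H1 j (lqV q fun i => w i) (by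
    intro k
    refine nr_le_lqV q w fun x => ?_
    fin_cases k
    · simpa using co w 1 x
    · simpa using co w 0 x
    · simp)
  have B2 := fun j => H2 j (lqV q fun i => v i) (fun k => nr_le_lqV q v (co v k))
  -- the rotated horizontal vorticity
  have hrot : ∀ x, ‖vecf (fun i => ![w 1, - w 0, (0 : 𝓢(E3, ℝ))] i) x‖ = ‖vecf (fun i => w i) x‖ := by
    intro x
    rw [EuclideanSpace.norm_eq, EuclideanSpace.norm_eq, Fin.sum_univ_three, Fin.sum_univ_three]
    simp only [vecf_apply]
    congr 1
    simp [hw]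
    ring
  have hdec : ∀ x, vecf (fun i => v i) x =
      vecf (fun i => ![w 1, - w 0, (0 : 𝓢(E3, ℝ))] i) x + (2:ℝ) • vecf (fun i => G i) x := by
    intro x
    ext i
    rw [PiLp.add_apply, PiLp.smul_apply, vecf_apply, vecf_apply, vecf_apply]
    fin_cases i <;> simp [hv, hG, hw] <;> ring
  have hGn : ∀ x, ‖(2:ℝ) • vecf (fun i => G i) x‖ ≤ 2 * (|G 0 x| + |G 1 x| + |G 2 x|) := by
    intro x
    rw [norm_smul, Real.norm_of_nonneg (by norm_num)]
    gcongr
    exact norm_le_sum _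
  have T1 := lqV_tri hq.le v w G (fun x => by
    rw [hdec x, ← hrot x]
    exact (norm_add_le _ _).trans (add_le_add le_rfl (hGn x)))
  have T2 := lqV_tri hq.le w v G (fun x => by
    rw [← hrot x, eq_sub_of_add_eq (hdec x).symm]
    exact (norm_sub_le _ _).trans (add_le_add le_rfl (hGn x)))
  have eG : ∀ j, nr q (G j) = nr q (pd j (u 2)) := fun j => by rw [hG, spd_coe]
  rw [eG, eG, eG] at T1 T2
  rw [ew, ev]
  constructor
  · rw [one_div, inv_mul_le_iff₀ (by linarith)]
    linarith [B2 0, B2 1, B2 2]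
  · linarith [B1 0, B1 1, B1 2]

/-- For `1 < q < ∞` there is `C_q ≥ 1` such that for every divergence-free Schwartz
vector field `u`, with `ω = ∇×u`, `ω_h = (ω₁,ω₂,0)` and `v³ = ∂₃u + ∇u₃`,
`(1/C_q)‖ω_h‖_{L^q} ≤ ‖v³‖_{L^q} ≤ C_q‖ω_h‖_{L^q}`. -/
theorem statement3 (q : ℝ) (hq : 1 < q) :
    ∃ C : ℝ, 1 ≤ C ∧ ∀ u : Fin 3 → 𝓢(E3, ℝ),
      (∀ x : E3, ∑ i, pd i (⇑(u i)) x = 0) →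
      ∀ (ω : Fin 3 → E3 → ℝ), ω = curl (fun i => ⇑(u i)) →
      ∀ (ωh : Fin 3 → E3 → ℝ), ωh = ![ω 0, ω 1, fun _ => 0] →
      ∀ (v3 : Fin 3 → E3 → ℝ), v3 = (fun j x => pd 2 (⇑(u j)) x + pd j (⇑(u 2)) x) →
      (1 / C) * lqV q ωh ≤ lqV q v3 ∧ lqV q v3 ≤ C * lqV q ωh := by
  exact statement_aux q hq
end
end
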